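/- For every deletion probability d ∈ (0,1), the capacity of the binary deletion channel satisfies C(BDC_d) > 0.1221·(1−d). Formally: for every real L, if C_n(d)/n converges to L as n → ∞, then L > 0.1221·(1−d). -/

import Mathlib

open Finset

/-- Mutual information of a joint distribution `q` on `α × β`, where the output
marginal is supported inside the finite set `Ys`. Terms with zero joint
probability vanish since they are multiplied by `q x y = 0`. -/
noncomputable def MI {α : Type*} [Fintype α] {β : Type*} [DecidableEq β]
    (q : α → β → ℝ) (Ys : Finset β) : ℝ :=
  ∑ x : α, ∑ y ∈ Ys, q x y *
    Real.logb 2 (q x y / ((∑ y' ∈ Ys, q x y') * (∑ x' : α, q x' y)))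

/-- `p` is a probability distribution on the finite type `α`. -/
def IsDist {α : Type*} [Fintype α] (p : α → ℝ) : Prop :=
  (∀ a, 0 ≤ p a) ∧ ∑ a : α, p a = 1

/-- The subsequence of `x` obtained by keeping exactly the positions in `S`. -/
def delOutput {n : ℕ} (x : Fin n → Bool) (S : Finset (Fin n)) : List Bool :=
  (S.sort (· ≤ ·)).map x

/-- All binary strings of length at most `n`. -/
def listsUpTo (n : ℕ) : Finset (List Bool) :=
  (Finset.range (n + 1)).biUnion
    (fun k => Finset.image (fun v : Fin k → Bool => List.ofFn v) Finset.univ)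

/-- Transition probability of the binary deletion channel `W_n^d`:
each bit is deleted independently with probability `d`. -/
noncomputable def Wdel (n : ℕ) (d : ℝ) (x : Fin n → Bool) (y : List Bool) : ℝ :=
  ∑ S : Finset (Fin n),
    if delOutput x S = y then (1 - d) ^ S.card * d ^ (n - S.card) else 0

/-- `C_n(d)`: the supremum of `I(X;Y)` over input distributions on `{0,1}^n`,
where `Y` is the output of the deletion channel `W_n^d` on input `X`. -/
noncomputable def Cdel (n : ℕ) (d : ℝ) : ℝ :=
  sSup { r | ∃ p : (Fin n → Bool) → ℝ, IsDist p ∧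
    r = MI (fun x y => p x * Wdel n d x y) (listsUpTo n) }

/-- Variational lower bound on mutual information, for an input that is a function of an
auxiliary variable: a scoring function `G` with `∑ a, q a * G a y ≤ 1` for each output `y`
certifies that the mutual information is at least the mean of `logb 2 G`. -/
theorem MI_pushforward_ge {α β A : Type*} [Fintype α] [DecidableEq α] [DecidableEq β] [Fintype A]
    (Ys : Finset β) (W : α → β → ℝ) (hW : ∀ x y, 0 ≤ W x y) (hW1 : ∀ x, ∑ y ∈ Ys, W x y = 1)
    (q : A → ℝ) (hq : ∀ a, 0 ≤ q a) (hq1 : ∑ a, q a = 1) (e : A → α)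
    (G : A → β → ℝ) (hG : ∀ a y, 0 < G a y) (hG1 : ∀ y, ∑ a, q a * G a y ≤ 1) :
    ∑ a, q a * ∑ y ∈ Ys, W (e a) y * Real.logb 2 (G a y) ≤
      MI (fun x y => (∑ a, if e a = x then q a else 0) * W x y) Ys := by
  set p : α → ℝ := fun x => ∑ a, if e a = x then q a else 0 with hp
  have hp0 : ∀ x, 0 ≤ p x := fun x => Finset.sum_nonneg fun a _ => by
    split_ifs; exacts [hq a, le_rfl]
  have hfib : ∀ F : α → ℝ, ∑ x, p x * F x = ∑ a, q a * F (e a) := by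
    intro F
    simp only [hp, Finset.sum_mul]
    rw [Finset.sum_comm]
    refine Finset.sum_congr rfl fun a _ => ?_
    simp [ite_mul]
  set r : β → ℝ := fun y => ∑ x, p x * W x y with hr
  have hr0 : ∀ y, 0 ≤ r y := fun y => Finset.sum_nonneg fun x _ => mul_nonneg (hp0 x) (hW x y)
  have hl2 : 0 < Real.log 2 := Real.log_pos (by norm_num)
  have hMI : MI (fun x y => p x * W x y) Ys =
      ∑ a, q a * ∑ y ∈ Ys, W (e a) y * Real.logb 2 (p (e a) * W (e a) y / (p (e a) * r y)) := by
    rw [← hfib fun x => ∑ y ∈ Ys, W x y * Real.logb 2 (p x * W x y / (p x * r y))]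
    simp only [MI, ← Finset.mul_sum, hW1, mul_one, mul_assoc]
    rfl
  change _ ≤ MI (fun x y => p x * W x y) Ys
  rw [hMI]
  have hterm : ∀ a, ∀ y, q a * (W (e a) y * Real.logb 2 (G a y)) +
      (q a * W (e a) y - r y * (q a * G a y)) / Real.log 2 ≤
      q a * (W (e a) y * Real.logb 2 (p (e a) * W (e a) y / (p (e a) * r y))) := by
    intro a y
    have hrG : 0 ≤ r y * (q a * G a y) := mul_nonneg (hr0 y) (mul_nonneg (hq a) (hG a y).le)
    rcases (hq a).eq_or_lt with h | hqa
    · simp [← h]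
    rcases (hW (e a) y).eq_or_lt with h | hWa
    · simp only [← h]
      simp only [zero_mul, mul_zero, zero_add, zero_sub]
      exact div_nonpos_of_nonpos_of_nonneg (by linarith) hl2.le
    have hpa : 0 < p (e a) := hqa.trans_le (by
      have := Finset.single_le_sum (f := fun a' => if e a' = e a then q a' else 0)
        (fun i _ => by split_ifs; exacts [hq i, le_rfl]) (Finset.mem_univ a)
      simpa using this)
    have hra : 0 < r y := (mul_pos hpa hWa).trans_le
      (Finset.single_le_sum (f := fun x => p x * W x y)
        (fun i _ => mul_nonneg (hp0 i) (hW i y)) (Finset.mem_univ (e a)))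
    have hGa := hG a y
    rw [mul_div_mul_left _ _ hpa.ne']
    have key : Real.log (G a y) + (1 - r y * G a y / W (e a) y) ≤ Real.log (W (e a) y / r y) := by
      have h1 := Real.log_le_sub_one_of_pos (x := r y * G a y / W (e a) y) (by positivity)
      rw [Real.log_div (by positivity) hWa.ne', Real.log_mul hra.ne' hGa.ne'] at h1
      rw [Real.log_div hWa.ne' hra.ne']
      linarith
    have h2 := mul_le_mul_of_nonneg_left key (mul_nonneg hqa.le hWa.le)
    simp only [Real.logb]
    rw [← sub_nonneg]
    have h3 : q a * (W (e a) y * (Real.log (W (e a) y / r y) / Real.log 2)) -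
        (q a * (W (e a) y * (Real.log (G a y) / Real.log 2)) +
          (q a * W (e a) y - r y * (q a * G a y)) / Real.log 2) =
        (q a * W (e a) y * Real.log (W (e a) y / r y) -
          q a * W (e a) y * (Real.log (G a y) + (1 - r y * G a y / W (e a) y))) / Real.log 2 := by
      field_simp
    rw [h3]
    exact div_nonneg (by linarith) hl2.le
  have hsum : ∑ a, ∑ y ∈ Ys, (q a * (W (e a) y * Real.logb 2 (G a y)) +
      (q a * W (e a) y - r y * (q a * G a y)) / Real.log 2) ≤
      ∑ a, ∑ y ∈ Ys, q a * (W (e a) y * Real.logb 2 (p (e a) * W (e a) y / (p (e a) * r y))) :=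
    Finset.sum_le_sum fun a _ => Finset.sum_le_sum fun y _ => hterm a y
  simp only [Finset.sum_add_distrib, ← Finset.mul_sum, ← Finset.sum_div,
    Finset.sum_sub_distrib] at hsum
  have h1 : ∑ a, q a * ∑ y ∈ Ys, W (e a) y = 1 := by simp [hW1, hq1]
  have h2 : ∑ a, ∑ y ∈ Ys, r y * (q a * G a y) ≤ 1 := by
    rw [Finset.sum_comm]
    simp only [← Finset.mul_sum]
    calc ∑ y ∈ Ys, r y * ∑ a, q a * G a y ≤ ∑ y ∈ Ys, r y * 1 :=
          Finset.sum_le_sum fun y _ => mul_le_mul_of_nonneg_left (hG1 y) (hr0 y)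
      _ = 1 := by
          simp only [hr, mul_one]
          rw [Finset.sum_comm]
          simp only [← Finset.mul_sum, hW1]
          rw [hfib fun _ => 1]
          simp [hq1]
  rw [h1] at hsum
  have : 0 ≤ (1 - ∑ a, ∑ y ∈ Ys, r y * (q a * G a y)) / Real.log 2 :=
    div_nonneg (by linarith) hl2.le
  linarith

theorem MI_le {α β : Type*} [Fintype α] [DecidableEq β]
    (Ys : Finset β) (W : α → β → ℝ) (hW : ∀ x y, 0 ≤ W x y) (hW1 : ∀ x, ∑ y ∈ Ys, W x y = 1)
    (p : α → ℝ) (hp : IsDist p) :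
    MI (fun x y => p x * W x y) Ys ≤ Fintype.card α / Real.log 2 := by
  have hl2 : 0 < Real.log 2 := Real.log_pos (by norm_num)
  have hterm : ∀ x y, p x * W x y *
      Real.logb 2 (p x * W x y / (p x * ∑ x', p x' * W x' y)) ≤ W x y / Real.log 2 := by
    intro x y
    rcases (hp.1 x).eq_or_lt with h | hx
    · simp only [← h, zero_mul]; exact div_nonneg (hW x y) hl2.le
    rcases (hW x y).eq_or_lt with h | hw
    · simp [← h]
    set r := ∑ x', p x' * W x' y
    have hr : p x * W x y ≤ r := Finset.single_le_sum (f := fun x => p x * W x y)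
        (fun i _ => mul_nonneg (hp.1 i) (hW i y)) (Finset.mem_univ x)
    have hr0 : 0 < r := (mul_pos hx hw).trans_le hr
    have h1 : p x * W x y / (p x * r) ≤ 1 / p x := by
      rw [div_le_div_iff₀ (by positivity) hx]
      nlinarith
    have h2 : Real.log (p x * W x y / (p x * r)) ≤ 1 / p x :=
      (Real.log_le_log (by positivity) h1).trans
        ((Real.log_le_sub_one_of_pos (by positivity)).trans (by linarith))
    have h3 := mul_le_mul_of_nonneg_left h2 (mul_pos hx hw).le
    rw [Real.logb, ← mul_div_assoc]
    refine div_le_div_of_nonneg_right (h3.trans (le_of_eq ?_)) hl2.le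
    field_simp
  calc MI (fun x y => p x * W x y) Ys ≤ ∑ x : α, ∑ y ∈ Ys, W x y / Real.log 2 := by
        unfold MI
        refine Finset.sum_le_sum fun x _ => Finset.sum_le_sum fun y _ => ?_
        rw [← Finset.mul_sum, hW1, mul_one]
        exact hterm x y
    _ = Fintype.card α / Real.log 2 := by
        simp [← Finset.sum_div, hW1]
        rw [div_eq_mul_inv]

/-- Expectation of `Φ` over the output of the deletion channel with input `x`. -/
noncomputable def delExp (d : ℝ) : List Bool → (List Bool → ℝ) → ℝ
  | [], Φ => Φ []
  | b :: x, Φ => d * delExp d x Φ + (1 - d) * delExp d x (fun y => Φ (b :: y))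

theorem delOutput_eq_filter {n : ℕ} (x : Fin n → Bool) (S : Finset (Fin n)) :
    delOutput x S = ((List.finRange n).filter (· ∈ S)).map x := by
  unfold delOutput
  congr 1
  refine List.Perm.eq_of_pairwise (le := (· ≤ ·)) (fun a b _ _ h1 h2 => le_antisymm h1 h2) (Finset.pairwise_sort _ _)
    (((List.pairwise_le_finRange n)).filter _) ?_
  rw [List.perm_ext_iff_of_nodup (Finset.sort_nodup _ _) ((List.nodup_finRange n).filter _)]
  simp

theorem sum_finset_fin_succ {n : ℕ} (F : Finset (Fin (n + 1)) → ℝ) :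
    ∑ S, F S = ∑ T : Finset (Fin n), F (T.map (Fin.succEmb n)) +
      ∑ T : Finset (Fin n), F (insert 0 (T.map (Fin.succEmb n))) := by
  have h0 : (0 : Fin (n + 1)) ∉ (univ : Finset (Fin n)).map (Fin.succEmb n) := by simp [Fin.succ_ne_zero]
  have h1 : (univ : Finset (Finset (Fin (n + 1)))) =
      (insert 0 ((univ : Finset (Fin n)).map (Fin.succEmb n))).powerset := by
    ext S
    simp only [mem_univ, mem_powerset, true_iff]
    intro i _
    refine Fin.cases ?_ (fun j => ?_) i <;> simp
  rw [h1, Finset.sum_powerset_insert h0]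
  have h2 : ∀ F : Finset (Fin (n + 1)) → ℝ,
      ∑ t ∈ ((univ : Finset (Fin n)).map (Fin.succEmb n)).powerset, F t =
        ∑ T : Finset (Fin n), F (T.map (Fin.succEmb n)) := by
    intro F
    refine (Finset.sum_bij (fun T _ => T.map (Fin.succEmb n)) (fun T _ => ?_) (fun a _ b _ h => ?_)
      (fun S hS => ?_) fun _ _ => rfl).symm
    · exact mem_powerset.2 (map_subset_map.2 (subset_univ T))
    · exact map_injective _ h
    · obtain ⟨T, _, hT⟩ := Finset.subset_map_iff.1 (mem_powerset.1 hS)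
      exact ⟨T, mem_univ T, hT.symm⟩
  rw [h2, h2]

theorem sum_delOutput {n : ℕ} (d : ℝ) (x : Fin n → Bool) (Φ : List Bool → ℝ) :
    ∑ S : Finset (Fin n), (1 - d) ^ S.card * d ^ (n - S.card) * Φ (delOutput x S) =
      delExp d (List.ofFn x) Φ := by
  induction n generalizing Φ with
  | zero =>
    have : (univ : Finset (Finset (Fin 0))) = {∅} := rfl
    rw [this, Finset.sum_singleton, delOutput_eq_filter]
    simp [delExp]
  | succ n ih =>
    rw [sum_finset_fin_succ, List.ofFn_succ, delExp, ← ih, ← ih, Finset.mul_sum, Finset.mul_sum]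
    congr 1
    · refine Finset.sum_congr rfl fun T _ => ?_
      have hc : T.card ≤ n := by simpa using T.card_le_univ
      have : delOutput x (T.map (Fin.succEmb n)) = delOutput (fun i => x i.succ) T := by
        simp only [delOutput_eq_filter, List.finRange_succ, List.filter_cons, List.filter_map]
        simp [Function.comp_def]
      rw [this, card_map, Nat.succ_sub hc, pow_succ]
      ring
    · refine Finset.sum_congr rfl fun T _ => ?_
      have : delOutput x (insert 0 (T.map (Fin.succEmb n))) =
          x 0 :: delOutput (fun i => x i.succ) T := by
        simp only [delOutput_eq_filter, List.finRange_succ, List.filter_cons, List.filter_map]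
        simp [Function.comp_def]
      rw [this, card_insert_of_notMem (by simp), card_map, Nat.succ_sub_succ, pow_succ]
      ring

theorem delOutput_mem {n : ℕ} (x : Fin n → Bool) (S : Finset (Fin n)) :
    delOutput x S ∈ listsUpTo n := by
  simp only [listsUpTo, mem_biUnion, mem_range, mem_image, mem_univ, true_and]
  refine ⟨(delOutput x S).length, ?_, fun i => (delOutput x S).get i, List.ofFn_get _⟩
  have hc : S.card ≤ n := by simpa using S.card_le_univ
  simp [delOutput]
  omega

theorem sum_Wdel_mul {n : ℕ} (d : ℝ) (x : Fin n → Bool) (Φ : List Bool → ℝ) :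
    ∑ y ∈ listsUpTo n, Wdel n d x y * Φ y = delExp d (List.ofFn x) Φ := by
  rw [← sum_delOutput]
  simp only [Wdel, Finset.sum_mul]
  rw [Finset.sum_comm]
  refine Finset.sum_congr rfl fun S _ => ?_
  rw [Finset.sum_eq_single_of_mem _ (delOutput_mem x S)]
  · simp
  · intro y _ hy
    simp [Ne.symm hy]

theorem Wdel_nonneg {n : ℕ} {d : ℝ} (hd₁ : 0 ≤ d) (hd₂ : d ≤ 1) (x : Fin n → Bool)
    (y : List Bool) : 0 ≤ Wdel n d x y := by
  refine Finset.sum_nonneg fun S _ => ?_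
  have : 0 ≤ 1 - d := by linarith
  split_ifs <;> positivity

theorem delExp_const (d : ℝ) (x : List Bool) (c : ℝ) : delExp d x (fun _ => c) = c := by
  induction x with
  | nil => rfl
  | cons b x ih => simp only [delExp, ih]; ring

theorem delExp_mono {d : ℝ} (hd₁ : 0 ≤ d) (hd₂ : d ≤ 1) (x : List Bool) {Φ Ψ : List Bool → ℝ}
    (h : ∀ y, Φ y ≤ Ψ y) : delExp d x Φ ≤ delExp d x Ψ := by
  induction x generalizing Φ Ψ with
  | nil => exact h _
  | cons b x ih =>
    have : 0 ≤ 1 - d := by linarith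
    exact add_le_add (mul_le_mul_of_nonneg_left (ih h) hd₁)
      (mul_le_mul_of_nonneg_left (ih fun y => h _) this)

theorem delExp_const_add (d : ℝ) (x : List Bool) (c : ℝ) (Φ : List Bool → ℝ) :
    delExp d x (fun y => c + Φ y) = c + delExp d x Φ := by
  induction x generalizing Φ with
  | nil => rfl
  | cons b x ih => simp only [delExp, ih]; ring

theorem sum_Wdel {n : ℕ} (d : ℝ) (x : Fin n → Bool) : ∑ y ∈ listsUpTo n, Wdel n d x y = 1 := by
  have := sum_Wdel_mul d x (fun _ => 1)
  simpa [delExp_const] using this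

/-- A constant run of length `N` leaves a binomial number of surviving bits. -/
theorem delExp_replicate_append (d : ℝ) (b : Bool) (N : ℕ) (x : List Bool)
    (Φ : List Bool → ℝ) :
    delExp d (List.replicate N b ++ x) Φ =
      ∑ D ∈ range (N + 1), (N.choose D * (1 - d) ^ D * d ^ (N - D)) *
        delExp d x (fun y => Φ (List.replicate D b ++ y)) := by
  induction N generalizing Φ with
  | zero => simp
  | succ N ih =>
    rw [List.replicate_succ, List.cons_append, delExp, ih, ih]
    set f : ℕ → ℝ := fun D => delExp d x (fun y => Φ (List.replicate D b ++ y)) with hf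
    have h2 : ∀ D, delExp d x (fun y => Φ (b :: (List.replicate D b ++ y))) = f (D + 1) := by
      intro D; simp [hf, List.replicate_succ]
    simp only [h2]
    change d * ∑ D ∈ range (N + 1), (N.choose D * (1 - d) ^ D * d ^ (N - D)) * f D + _ =
      ∑ D ∈ range (N + 1 + 1), ((N + 1).choose D * (1 - d) ^ D * d ^ (N + 1 - D)) * f D
    rw [Finset.sum_range_succ' _ (N + 1)]
    simp only [Nat.choose_succ_succ, Nat.cast_add, add_mul, Finset.sum_add_distrib]
    rw [Finset.mul_sum, Finset.mul_sum, Finset.sum_range_succ' _ N,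
      Finset.sum_range_succ (fun D => (N.choose (D + 1) : ℝ) * (1 - d) ^ (D + 1) *
        d ^ (N + 1 - (D + 1)) * f (D + 1)) N]
    have e1 : ∑ i ∈ range N, d * ((N.choose (i + 1) : ℝ) * (1 - d) ^ (i + 1) *
        d ^ (N - (i + 1)) * f (i + 1)) =
        ∑ i ∈ range N, (N.choose (i + 1) : ℝ) * (1 - d) ^ (i + 1) *
        d ^ (N + 1 - (i + 1)) * f (i + 1) := by
      refine Finset.sum_congr rfl fun i hi => ?_
      have : N + 1 - (i + 1) = (N - (i + 1)) + 1 := by have := mem_range.1 hi; omega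
      rw [this, pow_succ]; ring
    have e2 : ∑ i ∈ range (N + 1), (1 - d) * ((N.choose i : ℝ) * (1 - d) ^ i *
        d ^ (N - i) * f (i + 1)) =
        ∑ i ∈ range (N + 1), (N.choose i : ℝ) * (1 - d) ^ (i + 1) *
        d ^ (N + 1 - (i + 1)) * f (i + 1) := by
      refine Finset.sum_congr rfl fun i hi => ?_
      rw [Nat.add_sub_add_right, pow_succ]; ring
    rw [e1, e2]
    simp
    ring

/-- Expectation of `Φ` over lists of `M` independent letters with weights `w`. -/
noncomputable def listExp {α : Type*} [Fintype α] (w : α → ℝ) : ℕ → (List α → ℝ) → ℝ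
  | 0, Φ => Φ []
  | M + 1, Φ => ∑ a, w a * listExp w M (fun x => Φ (a :: x))

section listExp
variable {α β : Type*} [Fintype α] [Fintype β] {w : α → ℝ}

theorem listExp_eq_sum (w : α → ℝ) (M : ℕ) (Φ : List α → ℝ) :
    listExp w M Φ = ∑ a : Fin M → α, (∏ i, w (a i)) * Φ (List.ofFn a) := by
  induction M generalizing Φ with
  | zero => simp [listExp]
  | succ M ih =>
    rw [listExp, ← (Fin.consEquiv fun _ => α).sum_comp, Fintype.sum_prod_type]
    refine Finset.sum_congr rfl fun a _ => ?_
    rw [ih, Finset.mul_sum]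
    refine Finset.sum_congr rfl fun x _ => ?_
    simp [Fin.consEquiv, Fin.prod_univ_succ, List.ofFn_succ, mul_assoc]

theorem listExp_mono (hw : ∀ a, 0 ≤ w a) {M : ℕ} {Φ Ψ : List α → ℝ}
    (h : ∀ x, x.length = M → Φ x ≤ Ψ x) : listExp w M Φ ≤ listExp w M Ψ := by
  induction M generalizing Φ Ψ with
  | zero => exact h _ rfl
  | succ M ih =>
    exact Finset.sum_le_sum fun a _ => mul_le_mul_of_nonneg_left
      (ih fun x hx => h _ (by simp [hx])) (hw a)

theorem listExp_congr {M : ℕ} {Φ Ψ : List α → ℝ}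
    (h : ∀ x, x.length = M → Φ x = Ψ x) : listExp w M Φ = listExp w M Ψ := by
  induction M generalizing Φ Ψ with
  | zero => exact h _ rfl
  | succ M ih =>
    exact Finset.sum_congr rfl fun a _ => by rw [ih fun x hx => h _ (by simp [hx])]

theorem listExp_add (w : α → ℝ) (M : ℕ) (Φ Ψ : List α → ℝ) :
    listExp w M (fun x => Φ x + Ψ x) = listExp w M Φ + listExp w M Ψ := by
  induction M generalizing Φ Ψ with
  | zero => rfl
  | succ M ih => simp only [listExp, ih, mul_add, Finset.sum_add_distrib]

theorem listExp_const_mul (w : α → ℝ) (M : ℕ) (c : ℝ) (Φ : List α → ℝ) :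
    listExp w M (fun x => c * Φ x) = c * listExp w M Φ := by
  induction M generalizing Φ with
  | zero => rfl
  | succ M ih =>
    simp only [listExp, ih, Finset.mul_sum]
    exact Finset.sum_congr rfl fun a _ => by ring

theorem listExp_const (hw1 : ∑ a, w a = 1) (M : ℕ) (c : ℝ) : listExp w M (fun _ => c) = c := by
  induction M with
  | zero => rfl
  | succ M ih => simp only [listExp, ih, ← Finset.sum_mul, hw1, one_mul]

theorem listExp_sum {ι : Type*} (w : α → ℝ) (M : ℕ) (s : Finset ι) (Φ : ι → List α → ℝ) :
    listExp w M (fun x => ∑ i ∈ s, Φ i x) = ∑ i ∈ s, listExp w M (Φ i) := by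
  induction M generalizing Φ with
  | zero => rfl
  | succ M ih =>
    simp only [listExp, ih, Finset.mul_sum]
    rw [Finset.sum_comm]

theorem listExp_append (w : α → ℝ) (k r : ℕ) (Φ : List α → ℝ) :
    listExp w (k + r) Φ = listExp w k (fun u => listExp w r (fun v => Φ (u ++ v))) := by
  induction k generalizing Φ with
  | zero => simp [listExp]
  | succ k ih =>
    rw [Nat.succ_add]
    simp only [listExp, ih, List.cons_append]

theorem listExp_fst {p : α → ℝ} {q : α → β → ℝ} (hq : ∀ a, ∑ b, q a b = 1) (M : ℕ)
    (Φ : List α → ℝ) :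
    listExp (fun ab : α × β => p ab.1 * q ab.1 ab.2) M (fun x => Φ (x.map Prod.fst)) =
      listExp p M Φ := by
  induction M generalizing Φ with
  | zero => rfl
  | succ M ih =>
    simp only [listExp, List.map_cons]
    rw [Fintype.sum_prod_type]
    refine Finset.sum_congr rfl fun a _ => ?_
    simp only [ih fun x => Φ (a :: x)]
    rw [← Finset.sum_mul, ← Finset.mul_sum, hq, mul_one]

end listExp

/-- Alternating runs with the given lengths, the first of colour `b`. -/
def runBits : Bool → List ℕ → List Bool
  | _, [] => []
  | b, N :: Ns => List.replicate N b ++ runBits (!b) Ns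

@[simp] theorem length_runBits (b : Bool) (Ns : List ℕ) : (runBits b Ns).length = Ns.sum := by
  induction Ns generalizing b with
  | nil => rfl
  | cons N Ns ih => simp [runBits, ih]

theorem delExp_finset_sum_lower {d : ℝ} (x : List Bool) (c : ℝ) (Φ : List Bool → ℝ) (hd₁ : 0 ≤ d)
    (hd₂ : d ≤ 1) (Ψ : List Bool → ℝ) (h : ∀ y, c + Ψ y ≤ Φ y) : c + delExp d x Ψ ≤ delExp d x Φ := by
  rw [← delExp_const_add]
  exact delExp_mono hd₁ hd₂ x h

/-- Joint weight of a label `j` and the number `D` of surviving bits of its run. -/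
noncomputable def survival {J : Type*} {K : ℕ} (d : ℝ) (w : J × Fin (K + 1) → ℝ) (j : J) (D : ℕ) : ℝ :=
  ∑ t : Fin (K + 1), w (j, t) * ((t : ℕ).choose D * (1 - d) ^ D * d ^ ((t : ℕ) - D))

/-- A score that increases along the deletion channel by rewards with a potential `h` of drift `c`
has mean at least `M * c` up to an additive constant. -/
theorem potential_bound {J σ : Type*} [Fintype J] {K : ℕ} {d : ℝ} (hd₁ : 0 ≤ d) (hd₂ : d ≤ 1)
    (w : J × Fin (K + 1) → ℝ) (hw : ∀ a, 0 ≤ w a) (hw1 : ∑ a, w a = 1)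
    (nxt : σ → J → ℕ → σ) (rew : σ → J → ℕ → ℝ) (Sc : σ → Bool → List J → List Bool → ℝ)
    (h : σ → ℝ) (c C : ℝ)
    (hSc : ∀ s b j D x y, rew s j D + Sc (nxt s j D) (!b) x y ≤
      Sc s b (j :: x) (List.replicate D b ++ y))
    (hlow : ∀ s b y, h s - C ≤ Sc s b [] y)
    (hpot : ∀ s, h s + c ≤ ∑ j, ∑ D ∈ range (K + 1),
      survival d w j D * (rew s j D + h (nxt s j D)))
    (M : ℕ) (f : List (J × Fin (K + 1)) → List Bool) (s : σ) (b : Bool) :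
    M * c + h s - C ≤ listExp w M fun a =>
      delExp d (runBits b (a.map fun t => (t.2 : ℕ)) ++ f a) (Sc s b (a.map Prod.fst)) := by
  induction M generalizing f s b with
  | zero =>
    have h1 : delExp d (f []) (fun _ => h s - C) ≤ delExp d (f []) (Sc s b []) :=
      delExp_mono hd₁ hd₂ _ fun y => hlow s b y
    rw [delExp_const] at h1
    simpa [listExp, runBits] using h1
  | succ M ih =>
    have hd' : 0 ≤ 1 - d := by linarith
    have step : ∀ t : J × Fin (K + 1),
        ∑ D ∈ range ((t.2 : ℕ) + 1), ((t.2 : ℕ).choose D * (1 - d) ^ D * d ^ ((t.2 : ℕ) - D)) *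
          (rew s t.1 D + (M * c + h (nxt s t.1 D) - C)) ≤
        listExp w M (fun a => delExp d (runBits b ((t :: a).map fun t => (t.2 : ℕ)) ++ f (t :: a))
          (Sc s b ((t :: a).map Prod.fst))) := by
      intro t
      simp only [List.map_cons, runBits, List.append_assoc, delExp_replicate_append]
      rw [listExp_sum]
      refine Finset.sum_le_sum fun D _ => ?_
      rw [listExp_const_mul]
      refine mul_le_mul_of_nonneg_left ?_ (by positivity)
      have h1 := ih (fun a => f (t :: a)) (nxt s t.1 D) (!b)
      have h2 := listExp_add w M (fun _ => rew s t.1 D) (fun a =>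
        delExp d (runBits (!b) (a.map fun t => (t.2 : ℕ)) ++ f (t :: a))
          (Sc (nxt s t.1 D) (!b) (a.map Prod.fst)))
      rw [listExp_const hw1] at h2
      calc _ ≤ rew s t.1 D + _ := by gcongr
        _ = _ := h2.symm
        _ ≤ _ := listExp_mono hw fun a _ =>
            delExp_finset_sum_lower _ _ _ hd₁ hd₂ _ fun y => hSc s b t.1 D _ y
    have ext : ∀ t : J × Fin (K + 1), ∀ F : ℕ → ℝ,
        ∑ D ∈ range ((t.2 : ℕ) + 1), ((t.2 : ℕ).choose D * (1 - d) ^ D * d ^ ((t.2 : ℕ) - D)) *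
          F D =
        ∑ D ∈ range (K + 1), ((t.2 : ℕ).choose D * (1 - d) ^ D * d ^ ((t.2 : ℕ) - D)) * F D := by
      intro t F
      refine Finset.sum_subset (range_subset_range.2 (by omega)) fun D _ hD => ?_
      rw [Nat.choose_eq_zero_of_lt (by simpa using hD)]
      simp
    have bin1 : ∀ t : J × Fin (K + 1),
        ∑ D ∈ range (K + 1), ((t.2 : ℕ).choose D * (1 - d) ^ D * d ^ ((t.2 : ℕ) - D) : ℝ) = 1 := by
      intro t
      have := ext t fun _ => 1
      simp only [mul_one] at this
      rw [← this]
      have h3 := (add_pow (1 - d) d (t.2 : ℕ)).symm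
      rw [sub_add_cancel, one_pow] at h3
      exact (Finset.sum_congr rfl fun D _ => by ring).trans h3
    have total : ∑ j, ∑ D ∈ range (K + 1), survival d w j D = 1 := by
      rw [← hw1, Fintype.sum_prod_type]
      refine Finset.sum_congr rfl fun j _ => ?_
      simp only [survival]
      rw [Finset.sum_comm]
      refine Finset.sum_congr rfl fun t _ => ?_
      rw [← Finset.mul_sum, bin1 (j, t), mul_one]
    have regroup : ∀ F : J → ℕ → ℝ, ∑ t, w t * ∑ D ∈ range (K + 1),
        ((t.2 : ℕ).choose D * (1 - d) ^ D * d ^ ((t.2 : ℕ) - D)) * F t.1 D =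
        ∑ j, ∑ D ∈ range (K + 1), survival d w j D * F j D := by
      intro F
      rw [Fintype.sum_prod_type]
      refine Finset.sum_congr rfl fun j _ => ?_
      simp only [survival, Finset.sum_mul, Finset.mul_sum]
      rw [Finset.sum_comm]
      exact Finset.sum_congr rfl fun D _ => Finset.sum_congr rfl fun t _ => by ring
    calc ((M + 1 : ℕ) : ℝ) * c + h s - C = (h s + c) + (M * c - C) := by push_cast; ring
      _ ≤ ∑ j, ∑ D ∈ range (K + 1), survival d w j D * (rew s j D + h (nxt s j D)) +
          (M * c - C) * ∑ j, ∑ D ∈ range (K + 1), survival d w j D := by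
          rw [total, mul_one]; gcongr; exact hpot s
      _ = ∑ j, ∑ D ∈ range (K + 1), survival d w j D *
          (rew s j D + (M * c + h (nxt s j D) - C)) := by
          simp only [Finset.mul_sum, ← Finset.sum_add_distrib]
          exact Finset.sum_congr rfl fun j _ => Finset.sum_congr rfl fun D _ => by ring
      _ = ∑ t, w t * ∑ D ∈ range ((t.2 : ℕ) + 1),
          ((t.2 : ℕ).choose D * (1 - d) ^ D * d ^ ((t.2 : ℕ) - D)) *
          (rew s t.1 D + (M * c + h (nxt s t.1 D) - C)) := by
          rw [← regroup]
          exact Finset.sum_congr rfl fun t _ => by rw [← ext t]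
      _ ≤ _ := Finset.sum_le_sum fun t _ => mul_le_mul_of_nonneg_left (step t) (hw t)

/-- Run lengths of `y`, when it is preceded by `l` bits of colour `b`. -/
def runLens : Bool → ℕ → List Bool → List ℕ
  | _, l, [] => [l]
  | b, l, c :: y => if c = b then runLens b (l + 1) y else l :: runLens c 1 y

theorem runLens_replicate_same (b : Bool) (l D : ℕ) (y : List Bool) :
    runLens b l (List.replicate D b ++ y) = runLens b (l + D) y := by
  induction D generalizing l with
  | zero => rfl
  | succ D ih => rw [List.replicate_succ, List.cons_append, runLens, if_pos rfl, ih]; congr 1; ring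

theorem runLens_replicate_not (b : Bool) (l D : ℕ) (y : List Bool) :
    runLens b l (List.replicate (D + 1) (!b) ++ y) = l :: runLens (!b) (D + 1) y := by
  rw [List.replicate_succ, List.cons_append, runLens, if_neg (by simp), runLens_replicate_same]
  congr 2; ring

/-- The decoding score: the label list is parsed into groups of odd length, one for each output
run, with weight `g` for a group emitting a run of given length; `η` is the weight of giving up. -/
noncomputable def parseScore {J : Type*} (g : List J → ℕ → ℝ) (η : ℝ) : List ℕ → List J → ℝ
  | [], _ => 1
  | l :: ls, x => η + ∑ m ∈ range ((x.length + 1) / 2),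
      g (x.take (2 * m + 1)) l * parseScore g η ls (x.drop (2 * m + 1))

section parseScore
variable {J : Type*} {g : List J → ℕ → ℝ} {η : ℝ}

theorem le_parseScore (hg : ∀ u l, 0 ≤ g u l) (hη : 0 ≤ η) (hη1 : η ≤ 1) (ls : List ℕ)
    (x : List J) : η ≤ parseScore g η ls x := by
  induction ls generalizing x with
  | nil => exact hη1
  | cons l ls ih =>
    exact le_add_of_nonneg_right (Finset.sum_nonneg fun m _ => mul_nonneg (hg _ _)
      (hη.trans (ih _)))

theorem parseScore_group (hg : ∀ u l, 0 ≤ g u l) (hη : 0 ≤ η) (hη1 : η ≤ 1) (l : ℕ) (ls : List ℕ)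
    (u v : List J) {m : ℕ} (hu : u.length = 2 * m + 1) :
    g u l * parseScore g η ls v ≤ parseScore g η (l :: ls) (u ++ v) := by
  rw [parseScore]
  have h := Finset.single_le_sum (s := range (((u ++ v).length + 1) / 2))
    (f := fun m => g ((u ++ v).take (2 * m + 1)) l *
      parseScore g η ls ((u ++ v).drop (2 * m + 1)))
    (fun i _ => mul_nonneg (hg _ _) (hη.trans (le_parseScore hg hη hη1 _ _)))
    (a := m) (by rw [mem_range, List.length_append]; omega)
  simp only [← hu, List.take_left', List.drop_left'] at h
  linarith

/-- A pair of consecutive output runs may be parsed in two different ways. -/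
theorem parseScore_two_groups (hg : ∀ u l, 0 ≤ g u l) (hη : 0 ≤ η) (hη1 : η ≤ 1) (l₁ l₂ : ℕ)
    (ls : List ℕ) (a b c d : J) (v : List J) :
    (g [a, b, c] l₁ * g [d] l₂ + g [a] l₁ * g [b, c, d] l₂) * parseScore g η ls v ≤
      parseScore g η (l₁ :: l₂ :: ls) (a :: b :: c :: d :: v) := by
  have h1 := parseScore_group (m := 0) hg hη hη1 l₂ ls [d] v rfl
  have h2 := parseScore_group (m := 1) hg hη hη1 l₂ ls [b, c, d] v rfl
  rw [parseScore]
  have h : g [a] l₁ * parseScore g η (l₂ :: ls) (b :: c :: d :: v) +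
      g [a, b, c] l₁ * parseScore g η (l₂ :: ls) (d :: v) ≤ _ :=
    (le_of_eq (by simp [Finset.sum_range_succ])).trans (Finset.sum_le_sum_of_subset_of_nonneg
      (s := range 2) (t := range (((a :: b :: c :: d :: v).length + 1) / 2))
      (f := fun m => g ((a :: b :: c :: d :: v).take (2 * m + 1)) l₁ *
        parseScore g η (l₂ :: ls) ((a :: b :: c :: d :: v).drop (2 * m + 1)))
      (range_subset_range.2 (by simp only [List.length_cons]; omega))
      (fun i _ _ => mul_nonneg (hg _ _) (hη.trans (le_parseScore hg hη hη1 _ _))))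
  simp only [List.cons_append, List.nil_append] at h1 h2
  have h3 := mul_le_mul_of_nonneg_left h1 (hg [a, b, c] l₁)
  have h4 := mul_le_mul_of_nonneg_left h2 (hg [a] l₁)
  linarith

theorem listExp_parseScore_le [Fintype J] {p : J → ℝ} (hp : ∀ j, 0 ≤ p j) (hp1 : ∑ j, p j = 1)
    (hg : ∀ u l, 0 ≤ g u l)
    (hK : ∀ T l, ∑ m ∈ range T, listExp p (2 * m + 1) (fun u => g u l) ≤ 1 - η)
    (ls : List ℕ) (M : ℕ) : listExp p M (parseScore g η ls) ≤ 1 := by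
  induction ls generalizing M with
  | nil => exact (listExp_const hp1 M 1).le
  | cons l ls ih =>
    have h1 : listExp p M (parseScore g η (l :: ls)) = listExp p M (fun x => η +
        ∑ m ∈ range ((M + 1) / 2), g (x.take (2 * m + 1)) l *
          parseScore g η ls (x.drop (2 * m + 1))) :=
      listExp_congr fun x hx => by rw [parseScore, hx]
    rw [h1, listExp_add, listExp_const hp1, listExp_sum]
    have h2 : ∀ m ∈ range ((M + 1) / 2), listExp p M (fun x => g (x.take (2 * m + 1)) l *
          parseScore g η ls (x.drop (2 * m + 1))) ≤ listExp p (2 * m + 1) (fun u => g u l) := by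
      intro m hm
      obtain ⟨r, rfl⟩ : ∃ r, M = (2 * m + 1) + r :=
        ⟨M - (2 * m + 1), by have := mem_range.1 hm; omega⟩
      rw [listExp_append]
      refine listExp_mono hp fun u hu => ?_
      simp only [← hu, List.take_left', List.drop_left', listExp_const_mul]
      exact mul_le_of_le_one_right (hg _ _) (ih r)
    linarith [Finset.sum_le_sum h2, hK ((M + 1) / 2) l]

end parseScore

theorem le_Cdel {n : ℕ} {d : ℝ} (hd₁ : 0 ≤ d) (hd₂ : d ≤ 1) {A : Type*} [Fintype A] (q : A → ℝ)
    (hq : ∀ a, 0 ≤ q a) (hq1 : ∑ a, q a = 1) (e : A → Fin n → Bool) (G : A → List Bool → ℝ)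
    (hG : ∀ a y, 0 < G a y) (hG1 : ∀ y, ∑ a, q a * G a y ≤ 1) :
    ∑ a, q a * delExp d (List.ofFn (e a)) (fun y => Real.logb 2 (G a y)) ≤ Cdel n d := by
  simp only [← sum_Wdel_mul]
  refine (MI_pushforward_ge (listsUpTo n) (Wdel n d) (fun x y => Wdel_nonneg hd₁ hd₂ x y)
    (sum_Wdel d) q hq hq1 e G hG hG1).trans ?_
  refine le_csSup ⟨Fintype.card (Fin n → Bool) / Real.log 2, ?_⟩
    ⟨fun x => ∑ a, if e a = x then q a else 0, ⟨fun x => Finset.sum_nonneg fun a _ => ?_, ?_⟩, rfl⟩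
  · rintro r ⟨p, hp, rfl⟩
    exact MI_le _ _ (fun x y => Wdel_nonneg hd₁ hd₂ x y) (sum_Wdel d) p hp
  · split_ifs; exacts [hq a, le_rfl]
  · rw [Finset.sum_comm]; simp [hq1]

theorem listExp_sum_sub_sq {α : Type*} [Fintype α] {w : α → ℝ} (hw1 : ∑ a, w a = 1) (N : α → ℝ)
    (μ : ℝ) (hμ : ∑ a, w a * N a = μ) (M : ℕ) (z : ℝ) :
    listExp w M (fun x => (z + (x.map fun a => N a - μ).sum) ^ 2) =
      z ^ 2 + M * ∑ a, w a * (N a - μ) ^ 2 := by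
  induction M generalizing z with
  | zero => simp [listExp]
  | succ M ih =>
    simp only [listExp, List.map_cons, List.sum_cons, ← add_assoc, ih]
    have h : ∑ a, w a * (N a - μ) = 0 := by
      simp only [mul_sub, Finset.sum_sub_distrib, hμ, ← Finset.sum_mul, hw1]; ring
    calc _ = ∑ a, (w a * (z ^ 2 + M * ∑ a, w a * (N a - μ) ^ 2) + 2 * z * (w a * (N a - μ)) +
          w a * (N a - μ) ^ 2) := Finset.sum_congr rfl fun a _ => by ring
      _ = _ := by
        rw [Finset.sum_add_distrib, Finset.sum_add_distrib, ← Finset.sum_mul, ← Finset.mul_sum, h,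
          hw1]
        push_cast; ring

theorem listExp_nonneg {α : Type*} [Fintype α] {w : α → ℝ} (hw : ∀ a, 0 ≤ w a) {M : ℕ}
    {Φ : List α → ℝ} (h : ∀ x, 0 ≤ Φ x) : 0 ≤ listExp w M Φ := by
  induction M generalizing Φ with
  | zero => exact h _
  | succ M ih => exact Finset.sum_nonneg fun a _ => mul_nonneg (hw a) (ih fun x => h _)

/-- Chebyshev's inequality for the total length of `M` independent runs. -/
theorem listExp_long_le {α : Type*} [Fintype α] {w : α → ℝ} (hw : ∀ a, 0 ≤ w a)
    (hw1 : ∑ a, w a = 1) (N : α → ℕ) (μ τ : ℝ) (hμ : ∑ a, w a * N a = μ) (hτ : μ < τ) (M n : ℕ)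
    (hn : τ * M ≤ n) :
    M * listExp w M (fun x => if (x.map N).sum ≤ n then 0 else 1) ≤
      (∑ a, w a * (N a - μ) ^ 2) / (τ - μ) ^ 2 := by
  have hpos : 0 < τ - μ := by linarith
  have hv := listExp_sum_sub_sq hw1 (fun a => (N a : ℝ)) μ hμ M 0
  have h1 : listExp w M (fun x => (M * (τ - μ)) ^ 2 * (if (x.map N).sum ≤ n then 0 else 1)) ≤
      listExp w M (fun x => (0 + (x.map fun a => (N a : ℝ) - μ).sum) ^ 2) := by
    refine listExp_mono hw fun x hx => ?_
    split_ifs with h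
    · rw [mul_zero]; positivity
    · have hs : (x.map fun a => (N a : ℝ) - μ).sum = ((x.map N).sum : ℕ) - M * μ := by
        rw [← hx]
        clear * -
        induction x with
        | nil => simp
        | cons a x ih => simp only [List.map_cons, List.sum_cons, ih, List.length_cons]; push_cast; ring
      rw [mul_one, zero_add, hs]
      have : (n : ℝ) ≤ ((x.map N).sum : ℕ) := by exact_mod_cast (not_le.1 h).le
      have hM : (0 : ℝ) ≤ M := Nat.cast_nonneg M
      exact pow_le_pow_left₀ (by positivity) (by linarith) 2
  rw [hv, listExp_const_mul] at h1
  rcases M.eq_zero_or_pos with rfl | hM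
  · rw [Nat.cast_zero, zero_mul]
    exact div_nonneg (Finset.sum_nonneg fun a _ => mul_nonneg (hw a) (sq_nonneg _)) (sq_nonneg _)
  have hM' : (0 : ℝ) < M := by exact_mod_cast hM
  rw [le_div_iff₀ (by positivity)]
  refine le_of_mul_le_mul_left ?_ hM'
  calc _ = _ := by ring
    _ ≤ _ := h1
    _ = _ := by ring

theorem pow_mul_le_listExp {α : Type*} [Fintype α] {p : α → ℝ} {pm : ℝ} (hpm : 0 ≤ pm)
    (hp : ∀ a, pm ≤ p a) {Φ : List α → ℝ} (hΦ : ∀ x, 0 ≤ Φ x) (x : List α) :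
    pm ^ x.length * Φ x ≤ listExp p x.length Φ := by
  induction x generalizing Φ with
  | nil => simp [listExp]
  | cons a x ih =>
    have hp0 : ∀ a, 0 ≤ p a := fun a => hpm.trans (hp a)
    calc pm ^ (x.length + 1) * Φ (a :: x) = pm * (pm ^ x.length * Φ (a :: x)) := by ring
      _ ≤ p a * listExp p x.length (fun x => Φ (a :: x)) :=
        mul_le_mul (hp a) (ih fun x => hΦ _) (mul_nonneg (by positivity) (hΦ _)) (hp0 a)
      _ ≤ _ := Finset.single_le_sum (f := fun a => p a * listExp p x.length fun x => Φ (a :: x))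
        (fun a _ => mul_nonneg (hp0 a) (listExp_nonneg hp0 fun x => hΦ _)) (mem_univ a)

theorem ofFn_getD_eq {n : ℕ} (l : List Bool) (h : l.length ≤ n) :
    List.ofFn (fun i : Fin n => l.getD i false) = l ++ List.replicate (n - l.length) false := by
  refine List.ext_getElem (by simp; omega) fun i h1 h2 => ?_
  simp only [List.getElem_ofFn, List.getElem_append, List.getElem_replicate]
  split_ifs with h3
  · simp [h3]
  · simp [List.getElem?_eq_none (not_lt.1 h3)]

theorem linear_le_Cdel {J : Type*} [Fintype J] {K : ℕ} {d : ℝ} (hd₁ : 0 ≤ d) (hd₂ : d ≤ 1)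
    {p : J → ℝ} {pm : ℝ} (hpm : 0 < pm) (hp : ∀ j, pm ≤ p j) (hp1 : ∑ j, p j = 1)
    {ω : J → Fin (K + 1) → ℝ} (hω : ∀ j t, 0 ≤ ω j t) (hω1 : ∀ j, ∑ t, ω j t = 1)
    {g : List J → ℕ → ℝ} {η : ℝ} (hg : ∀ u l, 0 ≤ g u l) (hη : 0 < η) (hη1 : η ≤ 1)
    (hK : ∀ T l, ∑ m ∈ range T, listExp p (2 * m + 1) (fun u => g u l) ≤ 1 - η)
    {μ τ : ℝ} (hμ : ∑ a : J × Fin (K + 1), p a.1 * ω a.1 a.2 * ((a.2 : ℕ) : ℝ) = μ) (hτ : μ < τ)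
    (j₀ : J) (c C : ℝ)
    (hP : ∀ (M : ℕ) (f : List (J × Fin (K + 1)) → List Bool), M * c - C ≤
      listExp (fun a : J × Fin (K + 1) => p a.1 * ω a.1 a.2) M fun a =>
        delExp d (runBits false (a.map fun t => (t.2 : ℕ)) ++ f a) fun y =>
          Real.logb 2 (parseScore g η (runLens true 1 y) (j₀ :: a.map Prod.fst))) :
    ∃ C', ∀ M n : ℕ, τ * M ≤ n → M * c - C' ≤ Cdel n d := by
  have hp0 : ∀ j, 0 ≤ p j := fun j => hpm.le.trans (hp j)
  set w : J × Fin (K + 1) → ℝ := fun a => p a.1 * ω a.1 a.2 with hw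
  have hw0 : ∀ a, 0 ≤ w a := fun a => mul_nonneg (hp0 _) (hω _ _)
  have hw1 : ∑ a, w a = 1 := by
    simp only [hw, Fintype.sum_prod_type, ← Finset.mul_sum, hω1, mul_one, hp1]
  set S : List Bool → List J → ℝ := fun y x => p j₀ * parseScore g η (runLens true 1 y) (j₀ :: x)
  have hS_low : ∀ y x, p j₀ * η ≤ S y x := fun y x =>
    mul_le_mul_of_nonneg_left (le_parseScore hg hη.le hη1 _ _) (hp0 j₀)
  have hpj : 0 < p j₀ := hpm.trans_le (hp j₀)
  have hS_pos : ∀ y x, 0 < S y x := fun y x => (mul_pos hpj hη).trans_le (hS_low y x)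
  have hS1 : ∀ y M, listExp p M (S y) ≤ 1 := by
    intro y M
    refine le_trans ?_ (listExp_parseScore_le hp0 hp1 hg hK (runLens true 1 y) (M + 1))
    rw [listExp_const_mul]
    exact Finset.single_le_sum (f := fun a => p a * listExp p M
      (fun x => parseScore g η (runLens true 1 y) (a :: x))) (fun a _ => mul_nonneg (hp0 a)
      (listExp_nonneg hp0 fun x => hη.le.trans (le_parseScore hg hη.le hη1 _ _))) (mem_univ j₀)
  set B : ℝ := Real.logb 2 (1 / pm)
  have hS_up : ∀ y x, Real.logb 2 (S y x) ≤ x.length * B := by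
    intro y x
    have h1 := (pow_mul_le_listExp hpm.le hp (fun x => (hS_pos y x).le) x).trans (hS1 y x.length)
    have h2 : S y x ≤ (1 / pm) ^ x.length := by
      rw [one_div, inv_pow, ← one_div, le_div_iff₀ (by positivity)]
      linarith
    rw [← Real.logb_pow]
    exact Real.logb_le_logb_of_le (by norm_num) (hS_pos y x) h2
  have hpm1 : pm ≤ 1 := (hp j₀).trans
    (hp1 ▸ Finset.single_le_sum (fun j _ => hp0 j) (mem_univ j₀))
  have hB : 0 ≤ B := Real.logb_nonneg (by norm_num) (by rw [le_div_iff₀ hpm]; linarith)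
  set b : ℝ := Real.logb 2 (p j₀ * η)
  set V : ℝ := (∑ a : J × Fin (K + 1), w a * (((a.2 : ℕ) : ℝ) - μ) ^ 2) / (τ - μ) ^ 2
  refine ⟨C - Real.logb 2 (p j₀) + V * B + |b|, fun M n hn => ?_⟩
  let bits : List (J × Fin (K + 1)) → List Bool := fun x => runBits false (x.map fun t => (t.2 : ℕ))
  let e : (Fin M → J × Fin (K + 1)) → Fin n → Bool := fun a i =>
    (bits (List.ofFn a)).getD i false
  have main := le_Cdel hd₁ hd₂ (fun a : Fin M → J × Fin (K + 1) => ∏ i, w (a i))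
    (fun a => Finset.prod_nonneg fun i _ => hw0 _)
    (by simpa using (listExp_eq_sum w M fun _ => 1).symm.trans (listExp_const hw1 M 1))
    e (fun a y => S y ((List.ofFn a).map Prod.fst)) (fun a y => hS_pos _ _)
    (fun y => by
      rw [← listExp_eq_sum w M fun x => S y (x.map Prod.fst), listExp_fst hω1]
      exact hS1 y M)
  refine le_trans ?_ main
  rw [← listExp_eq_sum w M fun x => delExp d
    (List.ofFn fun i : Fin n => (bits x).getD i false) fun y => Real.logb 2 (S y (x.map Prod.fst))]
  set bad : List (J × Fin (K + 1)) → ℝ := fun x =>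
    if (x.map fun t => (t.2 : ℕ)).sum ≤ n then 0 else 1
  have hbad : M * listExp w M bad ≤ V := listExp_long_le hw0 hw1 (fun t => (t.2 : ℕ)) μ τ hμ hτ M n hn
  have hbad1 : listExp w M bad ≤ 1 := by
    refine (listExp_mono hw0 (Ψ := fun _ => 1) fun x _ => ?_).trans (listExp_const hw1 M 1).le
    simp only [bad]; split_ifs <;> norm_num
  have hcmp : ∀ x : List (J × Fin (K + 1)), x.length = M →
      delExp d (bits x ++ List.replicate (n - (bits x).length) false)
        (fun y => Real.logb 2 (S y (x.map Prod.fst))) + (-(M * B + |b|)) * bad x ≤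
      delExp d (List.ofFn fun i : Fin n => (bits x).getD i false)
        (fun y => Real.logb 2 (S y (x.map Prod.fst))) := by
    intro x hx
    by_cases h : (x.map fun t => (t.2 : ℕ)).sum ≤ n
    · rw [ofFn_getD_eq _ (by simpa [bits] using h)]
      simp [bad, h]
    · have h1 := delExp_mono hd₁ hd₂ (bits x ++ List.replicate (n - (bits x).length) false)
        (fun y => hS_up y (x.map Prod.fst))
      have h2 := delExp_mono hd₁ hd₂ (List.ofFn fun i : Fin n => (bits x).getD i false)
        (fun y => Real.logb_le_logb_of_le (b := 2) (by norm_num) (mul_pos hpj hη)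
          (hS_low y (x.map Prod.fst)))
      rw [delExp_const] at h1 h2
      simp only [List.length_map, hx] at h1
      simp only [bad, h, if_false, mul_one]
      have h3 := neg_abs_le b
      linarith
  refine le_trans ?_ (listExp_mono hw0 hcmp)
  rw [listExp_add, listExp_const_mul]
  have h1 := hP M fun x => List.replicate (n - (bits x).length) false
  have h2 : listExp w M (fun x => delExp d (bits x ++ List.replicate (n - (bits x).length) false)
        (fun y => Real.logb 2 (S y (x.map Prod.fst)))) =
      Real.logb 2 (p j₀) + listExp w M (fun x => delExp d (bits x ++ List.replicate
        (n - (bits x).length) false) (fun y =>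
          Real.logb 2 (parseScore g η (runLens true 1 y) (j₀ :: x.map Prod.fst)))) := by
    rw [← listExp_const hw1 M (Real.logb 2 (p j₀)), ← listExp_add]
    refine listExp_congr fun x _ => ?_
    rw [← delExp_const_add]
    congr 1
    funext y
    exact Real.logb_mul hpj.ne' (hη.trans_le (le_parseScore hg hη.le hη1 _ _)).ne'
  rw [h2]
  have h3 : (M * B + |b|) * listExp w M bad ≤ V * B + |b| := by
    have := mul_le_mul_of_nonneg_right hbad hB
    have := mul_le_mul_of_nonneg_left hbad1 (abs_nonneg b)
    nlinarith
  linarith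

/-- Lower bounds for the logarithmic weights of the groups of length one, three and five, and for the
gain `γ` from parsing the groups `[a, z, z]`, `[d]` also as `[a]`, `[z, z, d]`. -/
structure Rewards (J : Type*) where
  v₀ : J → ℕ → ℝ
  v₁ : J → J → J → ℕ → ℝ
  v₂ : J → J → J → J → J → ℕ → ℝ
  γ : J → ℕ → J → ℕ → ℝ
  z : J

/-- Expectation under the law `ρ` of a label and a number of surviving bits. -/
noncomputable def runExp {J : Type*} [Fintype J] (ρ : J → ℕ → ℝ) (K : ℕ) (F : J → ℕ → ℝ) : ℝ :=
  ∑ j, ∑ D ∈ range (K + 1), ρ j D * F j D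

/-- The part of the expectation where the run is completely deleted. -/
noncomputable def goneExp {J : Type*} [Fintype J] (ρ : J → ℕ → ℝ) (F : J → ℝ) : ℝ :=
  ∑ j, ρ j 0 * F j

/-- The part of the expectation where some bit of the run survives. -/
noncomputable def aliveExp {J : Type*} [Fintype J] (ρ : J → ℕ → ℝ) (K : ℕ) (F : J → ℕ → ℝ) : ℝ :=
  ∑ j, ∑ D ∈ range K, ρ j (D + 1) * F j (D + 1)

section runExp
variable {J : Type*} [Fintype J] {ρ : J → ℕ → ℝ} {K : ℕ}

theorem runExp_eq (F : J → ℕ → ℝ) :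
    runExp ρ K F = goneExp ρ (fun j => F j 0) + aliveExp ρ K F := by
  simp only [runExp, goneExp, aliveExp, ← Finset.sum_add_distrib, Finset.sum_range_succ']
  exact Finset.sum_congr rfl fun j _ => add_comm _ _

theorem runExp_mono (hρ : ∀ j D, 0 ≤ ρ j D) {F G : J → ℕ → ℝ} (h : ∀ j D, F j D ≤ G j D) :
    runExp ρ K F ≤ runExp ρ K G :=
  Finset.sum_le_sum fun j _ => Finset.sum_le_sum fun D _ => mul_le_mul_of_nonneg_left (h j D) (hρ j D)

theorem aliveExp_mono (hρ : ∀ j D, 0 ≤ ρ j D) {F G : J → ℕ → ℝ} (h : ∀ j D, F j D ≤ G j D) :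
    aliveExp ρ K F ≤ aliveExp ρ K G :=
  Finset.sum_le_sum fun j _ => Finset.sum_le_sum fun _ _ => mul_le_mul_of_nonneg_left (h j _) (hρ j _)

theorem goneExp_mono (hρ : ∀ j D, 0 ≤ ρ j D) {F G : J → ℝ} (h : ∀ j, F j ≤ G j) :
    goneExp ρ F ≤ goneExp ρ G :=
  Finset.sum_le_sum fun j _ => mul_le_mul_of_nonneg_left (h j) (hρ j 0)

theorem aliveExp_congr {F G : J → ℕ → ℝ} (h : ∀ j D, F j (D + 1) = G j (D + 1)) :
    aliveExp ρ K F = aliveExp ρ K G := by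
  simp only [aliveExp, h]

theorem aliveExp_add (F G : J → ℕ → ℝ) :
    aliveExp ρ K (fun j D => F j D + G j D) = aliveExp ρ K F + aliveExp ρ K G := by
  simp only [aliveExp, mul_add, Finset.sum_add_distrib]

theorem aliveExp_const_mul (a : ℝ) (F : J → ℕ → ℝ) :
    aliveExp ρ K (fun j D => a * F j D) = a * aliveExp ρ K F := by
  simp only [aliveExp, Finset.mul_sum]
  exact Finset.sum_congr rfl fun j _ => Finset.sum_congr rfl fun D _ => by ring

theorem goneExp_add (F G : J → ℝ) :
    goneExp ρ (fun j => F j + G j) = goneExp ρ F + goneExp ρ G := by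
  simp only [goneExp, mul_add, Finset.sum_add_distrib]

theorem goneExp_const (a : ℝ) : goneExp ρ (fun _ => a) = goneExp ρ (fun _ => 1) * a := by
  simp only [goneExp, mul_one, Finset.sum_mul]

theorem aliveExp_const (h1 : runExp ρ K (fun _ _ => 1) = 1) (a : ℝ) :
    aliveExp ρ K (fun _ _ => a) = (1 - goneExp ρ fun _ => 1) * a := by
  have h2 := aliveExp_const_mul (ρ := ρ) (K := K) a fun _ _ => 1
  rw [runExp_eq] at h1
  simp only [mul_one] at h2
  have h3 : aliveExp ρ K (fun _ _ => 1) = 1 - goneExp ρ fun _ => 1 := by linarith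
  rw [h2, h3]; ring

theorem runExp_const (h1 : runExp ρ K (fun _ _ => 1) = 1) (a : ℝ) :
    runExp ρ K (fun _ _ => a) = a := by
  rw [runExp_eq, goneExp_const, aliveExp_const h1]; ring

theorem goneExp_le (hρ : ∀ j D, 0 ≤ ρ j D) {F : J → ℝ} {B : ℝ} (h : ∀ j, F j ≤ B) :
    goneExp ρ F ≤ (goneExp ρ fun _ => 1) * B := by
  rw [← goneExp_const]; exact goneExp_mono hρ h

theorem aliveExp_le (hρ : ∀ j D, 0 ≤ ρ j D) (h1 : runExp ρ K (fun _ _ => 1) = 1) {F : J → ℕ → ℝ}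
    {B : ℝ} (h : ∀ j D, F j D ≤ B) : aliveExp ρ K F ≤ (1 - goneExp ρ fun _ => 1) * B := by
  rw [← aliveExp_const h1]; exact aliveExp_mono hρ h

theorem runExp_le (hρ : ∀ j D, 0 ≤ ρ j D) (h1 : runExp ρ K (fun _ _ => 1) = 1) {F : J → ℕ → ℝ}
    {B : ℝ} (h : ∀ j D, F j D ≤ B) : runExp ρ K F ≤ B := by
  rw [← runExp_const h1 B]; exact runExp_mono hρ h

theorem goneExp_one_nonneg (hρ : ∀ j D, 0 ≤ ρ j D) : 0 ≤ goneExp ρ fun _ => 1 :=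
  Finset.sum_nonneg fun j _ => mul_nonneg (hρ j 0) zero_le_one

theorem goneExp_one_le (hρ : ∀ j D, 0 ≤ ρ j D) (h1 : runExp ρ K (fun _ _ => 1) = 1) :
    (goneExp ρ fun _ => 1) ≤ 1 := by
  rw [runExp_eq] at h1
  have : 0 ≤ aliveExp ρ K fun _ _ => 1 :=
    Finset.sum_nonneg fun j _ => Finset.sum_nonneg fun D _ => mul_nonneg (hρ j _) zero_le_one
  linarith

end runExp

namespace Rewards
variable {J : Type*} [Fintype J] (R : Rewards J) (ρ : J → ℕ → ℝ) (K : ℕ) (c α : ℝ)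

/-- Potential of a pending group of five labels. -/
noncomputable def pot₅ (a b₁ c₁ b₂ c₂ : J) (l : ℕ) : ℝ :=
  (1 - goneExp ρ fun _ => 1) * R.v₂ a b₁ c₁ b₂ c₂ l - c + (goneExp ρ fun _ => 1) * (α - 3 - c)

/-- Potential of a pending group of four labels. -/
noncomputable def pot₄ (a b₁ c₁ b₂ : J) (l : ℕ) : ℝ :=
  runExp ρ K (fun c₂ D => R.pot₅ ρ c α a b₁ c₁ b₂ c₂ (l + D)) - c

open Classical in
/-- Potential of a pending group of three labels. -/
noncomputable def pot₃ (a b₁ c₁ : J) (l : ℕ) : ℝ :=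
  (1 - goneExp ρ fun _ => 1) * R.v₁ a b₁ c₁ l - c + goneExp ρ (fun b₂ => R.pot₄ ρ K c α a b₁ c₁ b₂ l) +
    if b₁ = R.z ∧ c₁ = R.z then
      (1 - goneExp ρ fun _ => 1) * aliveExp ρ K (fun d D => R.γ a l d D) else 0

/-- Potential of a pending group of two labels. -/
noncomputable def pot₂ (a b₁ : J) (l : ℕ) : ℝ :=
  runExp ρ K (fun c₁ D => R.pot₃ ρ K c α a b₁ c₁ (l + D)) - c

/-- Potential of a pending group of one label. -/
noncomputable def pot₁ (a : J) (l : ℕ) : ℝ :=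
  (1 - goneExp ρ fun _ => 1) * R.v₀ a l - c + goneExp ρ (fun b₁ => R.pot₂ ρ K c α a b₁ l)

end Rewards

/-- State of the parser: a pending group whose next run has the opposite colour (`odd`) or the same
colour (`even`), or a completed group `[a, z, z]` followed by a pending group `[d]` (`pool`). -/
inductive ParseState (J : Type*)
  | odd (u : List J) (hu : u.length % 2 = 1) (l : ℕ)
  | even (u : List J) (hu : u.length % 2 = 0 ∧ 2 ≤ u.length) (l : ℕ)
  | pool (a : J) (l₁ : ℕ) (d : J) (l₂ : ℕ)

namespace ParseState
variable {J : Type*}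

open Classical in
/-- State after a pending group `u` of odd length is completed by a run emitting `D` bits. -/
noncomputable def start (z : J) : List J → ℕ → J → ℕ → ParseState J
  | [a, b, c], l, j, D => if b = z ∧ c = z then pool a l j D else odd [j] rfl D
  | _, _, j, D => odd [j] rfl D

noncomputable def next (z : J) : ParseState J → J → ℕ → ParseState J
  | odd u hu l, j, 0 => even (u ++ [j]) (by simp; omega) l
  | odd u _ l, j, D + 1 => start z u l j (D + 1)
  | even u hu l, j, D => odd (u ++ [j]) (by simp; omega) (l + D)
  | pool _ _ d l₂, j, 0 => even [d, j] (by simp) l₂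
  | pool _ _ _ _, j, D + 1 => odd [j] rfl (D + 1)

open Classical in
/-- Reward for completing a group of odd length. -/
noncomputable def groupReward (R : Rewards J) (κ : ℝ) : List J → ℕ → ℝ
  | [a], l => R.v₀ a l
  | [a, b, c], l => if b = R.z ∧ c = R.z then 0 else R.v₁ a b c l
  | [a, b, c, b', c'], l => R.v₂ a b c b' c' l
  | u, _ => -κ - (u.length / 2 : ℕ)

noncomputable def reward (R : Rewards J) (κ : ℝ) : ParseState J → J → ℕ → ℝ
  | odd _ _ _, _, 0 => 0
  | odd u _ l, _, _ + 1 => groupReward R κ u l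
  | even _ _ _, _, _ => 0
  | pool a l₁ _ _, _, 0 => R.v₁ a R.z R.z l₁
  | pool a l₁ d l₂, _, _ + 1 => R.v₁ a R.z R.z l₁ + R.v₀ d l₂ + R.γ a l₁ d l₂

/-- Potential of a pending group of odd length. -/
noncomputable def oddPotential [Fintype J] (R : Rewards J) (ρ : J → ℕ → ℝ) (K : ℕ) (c α : ℝ) :
    List J → ℕ → ℝ
  | [a], l => R.pot₁ ρ K c α a l
  | [a, b, c'], l => R.pot₃ ρ K c α a b c' l
  | [a, b, c₁, b', c'], l => R.pot₅ ρ c α a b c₁ b' c' l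
  | u, _ => α - (u.length / 2 : ℕ)

/-- Potential of a pending group of even length. -/
noncomputable def evenPotential [Fintype J] (R : Rewards J) (ρ : J → ℕ → ℝ) (K : ℕ) (c α : ℝ) :
    List J → ℕ → ℝ
  | [a, b], l => R.pot₂ ρ K c α a b l
  | [a, b, c', b'], l => R.pot₄ ρ K c α a b c' b' l
  | u, _ => α - (u.length / 2 : ℕ) - c

noncomputable def potential [Fintype J] (R : Rewards J) (ρ : J → ℕ → ℝ) (K : ℕ) (c α : ℝ) :
    ParseState J → ℝ
  | odd u _ l => oddPotential R ρ K c α u l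
  | even u _ l => evenPotential R ρ K c α u l
  | pool a l₁ d l₂ => R.v₁ a R.z R.z l₁ + R.pot₁ ρ K c α d l₂ +
      (1 - goneExp ρ fun _ => 1) * R.γ a l₁ d l₂

noncomputable def score (g : List J → ℕ → ℝ) (η : ℝ) (z : J) :
    ParseState J → Bool → List J → List Bool → ℝ
  | odd u _ l, b, x, y => Real.logb 2 (parseScore g η (runLens (!b) l y) (u ++ x))
  | even u _ l, b, x, y => Real.logb 2 (parseScore g η (runLens b l y) (u ++ x))
  | pool a l₁ d l₂, b, x, y =>
    Real.logb 2 (parseScore g η (l₁ :: runLens (!b) l₂ y) (a :: z :: z :: d :: x))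

section potential
variable [Fintype J] {R : Rewards J} {ρ : J → ℕ → ℝ} {K : ℕ} {c α B : ℝ}

theorem potential_le (hρ : ∀ j D, 0 ≤ ρ j D) (h1 : runExp ρ K (fun _ _ => 1) = 1) (hc : 0 ≤ c)
    (hB : 0 ≤ B) (hα : α ≤ B) (h₀ : ∀ a l, R.v₀ a l ≤ B) (h₁ : ∀ a b d l, R.v₁ a b d l ≤ B)
    (h₂ : ∀ a b d b' d' l, R.v₂ a b d b' d' l ≤ B) (hγ : ∀ a l d l', R.γ a l d l' ≤ B)
    (s : ParseState J) : s.potential R ρ K c α ≤ 4 * B := by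
  have hp0 := goneExp_one_nonneg hρ
  have hp1 := goneExp_one_le hρ h1
  have hq : 0 ≤ 1 - goneExp ρ fun _ => 1 := sub_nonneg.2 hp1
  have hq1 : 1 - (goneExp ρ fun _ => 1) ≤ 1 := by linarith
  have h5 : ∀ a b d b' d' l, R.pot₅ ρ c α a b d b' d' l ≤ B := by
    intro a b d b' d' l
    have := mul_le_mul_of_nonneg_left (h₂ a b d b' d' l) hq
    have := mul_le_mul_of_nonneg_left (show α - 3 - c ≤ B by linarith) hp0
    rw [Rewards.pot₅]; linarith
  have h4 : ∀ a b d b' l, R.pot₄ ρ K c α a b d b' l ≤ B := by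
    intro a b d b' l
    have := runExp_le hρ h1 (F := fun c₂ D => R.pot₅ ρ c α a b d b' c₂ (l + D)) fun j D => h5 _ _ _ _ _ _
    rw [Rewards.pot₄]; linarith
  have h3 : ∀ a b d l, R.pot₃ ρ K c α a b d l ≤ 2 * B := by
    intro a b d l
    have := mul_le_mul_of_nonneg_left (h₁ a b d l) hq
    have := goneExp_le hρ (F := fun b₂ => R.pot₄ ρ K c α a b d b₂ l) fun j => h4 _ _ _ _ _
    have h6 : (1 - goneExp ρ fun _ => 1) * aliveExp ρ K (fun d D => R.γ a l d D) ≤ B := by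
      have h7 := aliveExp_le hρ h1 (F := fun d D => R.γ a l d D) fun j D => hγ _ _ _ _
      have h8 := mul_le_mul_of_nonneg_right hq1 hB
      have h9 := mul_le_mul_of_nonneg_left (h7.trans h8) hq
      linarith
    rw [Rewards.pot₃]
    split_ifs <;> linarith
  have h2 : ∀ a b l, R.pot₂ ρ K c α a b l ≤ 2 * B := by
    intro a b l
    have := runExp_le hρ h1 (F := fun c₁ D => R.pot₃ ρ K c α a b c₁ (l + D)) fun j D => h3 _ _ _ _
    rw [Rewards.pot₂]; linarith
  have h1' : ∀ a l, R.pot₁ ρ K c α a l ≤ 2 * B := by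
    intro a l
    have := mul_le_mul_of_nonneg_left (h₀ a l) hq
    have := goneExp_le hρ (F := fun b₁ => R.pot₂ ρ K c α a b₁ l) fun j => h2 _ _ _
    have := mul_le_mul_of_nonneg_right hp1 hB
    rw [Rewards.pot₁]; linarith
  have hn : ∀ m : ℕ, (0 : ℝ) ≤ m := Nat.cast_nonneg
  rcases s with ⟨u, hu, l⟩ | ⟨u, hu, l⟩ | ⟨a, l₁, d, l₂⟩
  · rcases u with _ | ⟨a, _ | ⟨b, _ | ⟨c₁, _ | ⟨b', _ | ⟨c', _ | ⟨e, u⟩⟩⟩⟩⟩⟩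
    · simp at hu
    · exact (h1' a l).trans (by linarith)
    · simp at hu
    · exact (h3 a b c₁ l).trans (by linarith)
    · simp at hu
    · exact (h5 a b c₁ b' c' l).trans (by linarith)
    · simp only [potential, oddPotential]
      linarith [hn ((a :: b :: c₁ :: b' :: c' :: e :: u).length / 2)]
  · rcases u with _ | ⟨a, _ | ⟨b, _ | ⟨c₁, _ | ⟨b', _ | ⟨c', u⟩⟩⟩⟩⟩
    · simp at hu
    · simp at hu
    · exact (h2 a b l).trans (by linarith)
    · simp at hu
    · exact (h4 a b c₁ b' l).trans (by linarith)
    · simp only [potential, evenPotential]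
      linarith [hn ((a :: b :: c₁ :: b' :: c' :: u).length / 2)]
  · have h6 := mul_le_mul_of_nonneg_left (hγ a l₁ d l₂) hq
    have h7 := mul_le_mul_of_nonneg_right hq1 hB
    simp only [potential]
    linarith [h₁ a R.z R.z l₁, h1' d l₂]

theorem potential_add_le (h1 : runExp ρ K (fun _ _ => 1) = 1) {κ : ℝ}
    (hbar : 0 ≤ aliveExp ρ K fun a D => R.pot₁ ρ K c α a D)
    (hα : (1 - goneExp ρ fun _ => 1) * (α + κ) + (goneExp ρ fun _ => 1) +
      c * (1 + goneExp ρ fun _ => 1) ≤ 0) (s : ParseState J) :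
    s.potential R ρ K c α + c ≤ runExp ρ K fun j D =>
      s.reward R κ j D + (s.next R.z j D).potential R ρ K c α := by
  set p₀ := goneExp ρ fun _ => 1 with hp₀
  rcases s with ⟨u, hu, l⟩ | ⟨u, hu, l⟩ | ⟨a, l₁, d, l₂⟩
  · rw [runExp_eq]
    rcases u with _ | ⟨a, _ | ⟨b, _ | ⟨c₁, _ | ⟨b', _ | ⟨c', _ | ⟨e, u⟩⟩⟩⟩⟩⟩
    · simp at hu
    · simp only [potential, next, reward, List.singleton_append, zero_add, oddPotential, evenPotential]
      rw [aliveExp_congr (G := fun j D => R.v₀ a l + R.pot₁ ρ K c α j D) fun _ _ => rfl,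
        aliveExp_add, aliveExp_const h1, Rewards.pot₁]
      linarith
    · simp at hu
    · simp only [potential, next, reward, List.cons_append, List.nil_append, zero_add, oddPotential,
        evenPotential]
      by_cases hz : b = R.z ∧ c₁ = R.z
      · rw [aliveExp_congr (G := fun j D => R.v₁ a b c₁ l + (R.pot₁ ρ K c α j D +
          (1 - p₀) * R.γ a l j D)) fun _ _ => by
            simp only [groupReward, start, if_pos hz, ← hp₀]
            rw [hz.1, hz.2]; ring,
          aliveExp_add, aliveExp_add, aliveExp_const_mul, aliveExp_const h1, Rewards.pot₃, if_pos hz]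
        linarith
      · rw [aliveExp_congr (G := fun j D => R.v₁ a b c₁ l + R.pot₁ ρ K c α j D) fun _ _ => by
            simp only [groupReward, start, if_neg hz],
          aliveExp_add, aliveExp_const h1, Rewards.pot₃, if_neg hz]
        linarith
    · simp at hu
    · simp only [potential, next, reward, List.cons_append, List.nil_append, zero_add, oddPotential,
        evenPotential]
      rw [aliveExp_congr (G := fun j D => R.v₂ a b c₁ b' c' l + R.pot₁ ρ K c α j D) fun _ _ => rfl,
        aliveExp_add, aliveExp_const h1, Rewards.pot₅]
      simp only [List.length_cons, List.length_nil]
      norm_num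
      rw [goneExp_const (α - 3 - c)]
      linarith
    · set v := a :: b :: c₁ :: b' :: c' :: e :: u with hv
      have hl : ∀ j, (v ++ [j]).length / 2 = v.length / 2 + 1 := fun j => by
        simp only [List.length_append, List.length_singleton]; omega
      rw [aliveExp_congr (G := fun j D => (-κ - (v.length / 2 : ℕ)) + R.pot₁ ρ K c α j D)
          fun _ _ => rfl, aliveExp_add, aliveExp_const h1]
      simp only [potential, next, reward, zero_add]
      rw [show oddPotential R ρ K c α v l = α - (v.length / 2 : ℕ) from rfl,
        show (fun j => evenPotential R ρ K c α (v ++ [j]) l) = fun _ =>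
          α - ((v.length / 2 : ℕ) + 1) - c from funext fun j => by
            rw [← Nat.cast_add_one, ← hl j]; rfl, goneExp_const (α - ((v.length / 2 : ℕ) + 1) - c)]
      linarith
  · rcases u with _ | ⟨a, _ | ⟨b, _ | ⟨c₁, _ | ⟨b', _ | ⟨c', u⟩⟩⟩⟩⟩
    · simp at hu
    · simp at hu
    · simp only [potential, next, reward, List.cons_append, List.nil_append, zero_add, oddPotential,
        evenPotential, Rewards.pot₂]
      linarith
    · simp at hu
    · simp only [potential, next, reward, List.cons_append, List.nil_append, zero_add, oddPotential,
        evenPotential, Rewards.pot₄]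
      linarith
    · set v := a :: b :: c₁ :: b' :: c' :: u with hv
      have hl : ∀ j, (v ++ [j]).length / 2 = v.length / 2 := fun j => by
        simp only [List.length_append, List.length_singleton]; omega
      simp only [potential, next, reward, zero_add]
      rw [show evenPotential R ρ K c α v l = α - (v.length / 2 : ℕ) - c from rfl,
        show (fun j D => oddPotential R ρ K c α (v ++ [j]) (l + D)) = fun _ _ =>
          α - (v.length / 2 : ℕ) from funext fun j => funext fun D => by
            rw [← hl j]
            rcases u with _ | ⟨e, u⟩
            · simp [hv] at hu
            · rfl, runExp_const h1]
      linarith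
  · rw [runExp_eq]
    simp only [potential, next, reward, oddPotential, evenPotential]
    rw [aliveExp_congr (G := fun j D => (R.v₁ a R.z R.z l₁ + R.v₀ d l₂ + R.γ a l₁ d l₂) +
      R.pot₁ ρ K c α j D) fun _ _ => rfl, aliveExp_add, aliveExp_const h1, goneExp_add,
      goneExp_const (R.v₁ a R.z R.z l₁), Rewards.pot₁]
    linarith

end potential

section score
variable {R : Rewards J} {g : List J → ℕ → ℝ} {η κ : ℝ}

theorem groupReward_le (hv₀ : ∀ a l, R.v₀ a l ≤ Real.logb 2 (g [a] l))
    (hv₁ : ∀ a b c l, R.v₁ a b c l ≤ Real.logb 2 (g [a, b, c] l))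
    (hv₂ : ∀ a b c b' c' l, R.v₂ a b c b' c' l ≤ Real.logb 2 (g [a, b, c, b', c'] l))
    (hκ : ∀ u l, 7 ≤ u.length → -κ - (u.length / 2 : ℕ) ≤ Real.logb 2 (g u l))
    (u : List J) (hu : u.length % 2 = 1) (l : ℕ) (hz : ¬∃ a, u = [a, R.z, R.z]) :
    groupReward R κ u l ≤ Real.logb 2 (g u l) := by
  rcases u with _ | ⟨a, _ | ⟨b, _ | ⟨c₁, _ | ⟨b', _ | ⟨c', _ | ⟨e, u⟩⟩⟩⟩⟩⟩
  · simp at hu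
  · exact hv₀ a l
  · simp at hu
  · rw [groupReward, if_neg fun h => hz ⟨a, by rw [h.1, h.2]⟩]
    exact hv₁ a b c₁ l
  · simp at hu
  · exact hv₂ a b c₁ b' c' l
  · refine hκ _ l ?_
    simp only [List.length_cons] at hu ⊢
    omega

theorem logb_group_add_le (hg : ∀ u l, 0 < g u l) (hη : 0 < η) (hη1 : η ≤ 1) (l : ℕ) (ls : List ℕ)
    (u v : List J) (hu : u.length % 2 = 1) :
    Real.logb 2 (g u l) + Real.logb 2 (parseScore g η ls v) ≤
      Real.logb 2 (parseScore g η (l :: ls) (u ++ v)) := by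
  have h := hη.trans_le (le_parseScore (fun u l => (hg u l).le) hη.le hη1 ls v)
  rw [← Real.logb_mul (hg u l).ne' h.ne']
  exact Real.logb_le_logb_of_le one_lt_two (mul_pos (hg u l) h)
    (parseScore_group (fun u l => (hg u l).le) hη.le hη1 l ls u v (m := u.length / 2) (by omega))

theorem reward_add_score_le (hg : ∀ u l, 0 < g u l) (hη : 0 < η) (hη1 : η ≤ 1)
    (hv₀ : ∀ a l, R.v₀ a l ≤ Real.logb 2 (g [a] l))
    (hv₁ : ∀ a b c l, R.v₁ a b c l ≤ Real.logb 2 (g [a, b, c] l))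
    (hv₂ : ∀ a b c b' c' l, R.v₂ a b c b' c' l ≤ Real.logb 2 (g [a, b, c, b', c'] l))
    (hκ : ∀ u l, 7 ≤ u.length → -κ - (u.length / 2 : ℕ) ≤ Real.logb 2 (g u l))
    (hγ : ∀ a l₁ d l₂, R.v₁ a R.z R.z l₁ + R.v₀ d l₂ + R.γ a l₁ d l₂ ≤
      Real.logb 2 (g [a, R.z, R.z] l₁ * g [d] l₂ + g [a] l₁ * g [R.z, R.z, d] l₂))
    (s : ParseState J) (b : Bool) (j : J) (D : ℕ) (x : List J) (y : List Bool) :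
    s.reward R κ j D + (s.next R.z j D).score g η R.z (!b) x y ≤
      s.score g η R.z b (j :: x) (List.replicate D b ++ y) := by
  have hr : ∀ (b : Bool) (l D : ℕ), runLens (!b) l (List.replicate (D + 1) b ++ y) =
      l :: runLens b (D + 1) y := fun b l D => by
    have := runLens_replicate_not (!b) l D y
    rwa [Bool.not_not] at this
  rcases s with ⟨u, hu, l⟩ | ⟨u, hu, l⟩ | ⟨a, l₁, d, l₂⟩
  · rcases D with _ | D
    · simp [reward, next, score]
    · simp only [reward, next, score, hr]
      by_cases hz : ∃ a, u = [a, R.z, R.z]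
      · obtain ⟨a, rfl⟩ := hz
        simp [groupReward, start]
      · have hs : start R.z u l j (D + 1) = odd [j] rfl (D + 1) := by
          rcases u with _ | ⟨a, _ | ⟨b, _ | ⟨c₁, _ | ⟨b', u⟩⟩⟩⟩
          · rfl
          · rfl
          · rfl
          · rw [start, if_neg fun h => hz ⟨a, by rw [h.1, h.2]⟩]
          · rfl
        rw [hs]
        simp only [Bool.not_not, List.singleton_append]
        exact (add_le_add_left (groupReward_le hv₀ hv₁ hv₂ hκ u hu l hz) _).trans
          (logb_group_add_le hg hη hη1 l _ u (j :: x) hu)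
  · simp [reward, next, score, runLens_replicate_same]
  · rcases D with _ | D
    · simp only [reward, next, score, List.replicate_zero, List.nil_append]
      exact (add_le_add_left (hv₁ a R.z R.z l₁) _).trans
        (logb_group_add_le hg hη hη1 l₁ _ [a, R.z, R.z] (d :: j :: x) (by simp))
    · simp only [reward, next, score, hr, Bool.not_not, List.singleton_append]
      have h := hη.trans_le (le_parseScore (fun u l => (hg u l).le) hη.le hη1
        (runLens b (D + 1) y) (j :: x))
      have h2 := add_pos (mul_pos (hg [a, R.z, R.z] l₁) (hg [d] l₂))
        (mul_pos (hg [a] l₁) (hg [R.z, R.z, d] l₂))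
      refine (add_le_add_left (hγ a l₁ d l₂) _).trans ?_
      rw [← Real.logb_mul h2.ne' h.ne']
      exact Real.logb_le_logb_of_le one_lt_two (mul_pos h2 h)
        (parseScore_two_groups (fun u l => (hg u l).le) hη.le hη1 l₁ l₂ _ a R.z R.z d (j :: x))

theorem logb_le_score (hg : ∀ u l, 0 < g u l) (hη : 0 < η) (hη1 : η ≤ 1) (z : J)
    (s : ParseState J) (b : Bool) (x : List J) (y : List Bool) :
    Real.logb 2 η ≤ s.score g η z b x y := by
  rcases s with ⟨u, hu, l⟩ | ⟨u, hu, l⟩ | ⟨a, l₁, d, l₂⟩ <;>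
  exact Real.logb_le_logb_of_le one_lt_two hη
    (le_parseScore (fun u l => (hg u l).le) hη.le hη1 _ _)

end score

end ParseState

theorem sum_survival {J : Type*} {K : ℕ} (d : ℝ) (w : J × Fin (K + 1) → ℝ) (j : J) :
    ∑ D ∈ range (K + 1), survival d w j D = ∑ t, w (j, t) := by
  simp only [survival]
  rw [Finset.sum_comm]
  refine Finset.sum_congr rfl fun t _ => ?_
  rw [← Finset.mul_sum]
  have h : ∑ D ∈ range (K + 1), ((t : ℕ).choose D * (1 - d) ^ D * d ^ ((t : ℕ) - D) : ℝ) = 1 := by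
    rw [← Finset.sum_subset (range_subset_range.2 (Nat.succ_le_succ (Nat.lt_succ_iff.1 t.2)))
      fun D _ hD => by rw [Nat.choose_eq_zero_of_lt (by simpa using hD)]; simp]
    have := (add_pow (1 - d) d (t : ℕ)).symm
    rw [sub_add_cancel, one_pow] at this
    exact (Finset.sum_congr rfl fun D _ => by ring).trans this
  rw [h, mul_one]

/-- Lower bound on the mean logarithmic score of the parsing decoder. -/
theorem exists_le_listExp_parseScore {J : Type*} [Fintype J] {K : ℕ} {d : ℝ} (hd₁ : 0 ≤ d)
    (hd₂ : d ≤ 1) (w : J × Fin (K + 1) → ℝ) (hw : ∀ a, 0 ≤ w a) (hw1 : ∑ a, w a = 1)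
    {R : Rewards J} {g : List J → ℕ → ℝ} {η κ c B : ℝ} (hc : 0 ≤ c) (hB : 0 ≤ B)
    (h₀ : ∀ a l, R.v₀ a l ≤ B) (h₁ : ∀ a b d l, R.v₁ a b d l ≤ B)
    (h₂ : ∀ a b d b' d' l, R.v₂ a b d b' d' l ≤ B) (hγB : ∀ a l d l', R.γ a l d l' ≤ B)
    (hg : ∀ u l, 0 < g u l) (hη : 0 < η) (hη1 : η ≤ 1)
    (hv₀ : ∀ a l, R.v₀ a l ≤ Real.logb 2 (g [a] l))
    (hv₁ : ∀ a b c l, R.v₁ a b c l ≤ Real.logb 2 (g [a, b, c] l))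
    (hv₂ : ∀ a b c b' c' l, R.v₂ a b c b' c' l ≤ Real.logb 2 (g [a, b, c, b', c'] l))
    (hκ : ∀ u l, 7 ≤ u.length → -κ - (u.length / 2 : ℕ) ≤ Real.logb 2 (g u l))
    (hγ : ∀ a l₁ d l₂, R.v₁ a R.z R.z l₁ + R.v₀ d l₂ + R.γ a l₁ d l₂ ≤
      Real.logb 2 (g [a, R.z, R.z] l₁ * g [d] l₂ + g [a] l₁ * g [R.z, R.z, d] l₂))
    {α : ℝ} (hα0 : α ≤ 0)
    (hα : (1 - goneExp (survival d w) fun _ => 1) * (α + κ) + (goneExp (survival d w) fun _ => 1) +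
      c * (1 + goneExp (survival d w) fun _ => 1) ≤ 0)
    (hbar : 0 ≤ aliveExp (survival d w) K fun a D => R.pot₁ (survival d w) K c α a D)
    (j₀ : J) :
    ∃ C, ∀ (M : ℕ) (f : List (J × Fin (K + 1)) → List Bool), M * c - C ≤
      listExp w M fun a => delExp d (runBits false (a.map fun t => (t.2 : ℕ)) ++ f a) fun y =>
        Real.logb 2 (parseScore g η (runLens true 1 y) (j₀ :: a.map Prod.fst)) := by
  have hρ : ∀ j D, 0 ≤ survival d w j D := fun j D => Finset.sum_nonneg fun t _ =>
    mul_nonneg (hw _) (by have : 0 ≤ 1 - d := by linarith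
                          positivity)
  have h1 : runExp (survival d w) K (fun _ _ => 1) = 1 := by
    simp only [runExp, mul_one, sum_survival, ← Fintype.sum_prod_type', hw1]
  set s₀ : ParseState J := ParseState.odd [j₀] rfl 1
  refine ⟨4 * B - Real.logb 2 η - s₀.potential R (survival d w) K c α, fun M f => ?_⟩
  have h := potential_bound hd₁ hd₂ w hw hw1 (ParseState.next R.z) (ParseState.reward R κ)
    (ParseState.score g η R.z) (ParseState.potential R (survival d w) K c α) c (4 * B - Real.logb 2 η)
    (ParseState.reward_add_score_le hg hη hη1 hv₀ hv₁ hv₂ hκ hγ)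
    (fun s b y => by
      have := ParseState.potential_le hρ h1 hc hB (hα0.trans hB) h₀ h₁ h₂ hγB s
      linarith [ParseState.logb_le_score hg hη hη1 R.z s b [] y])
    (ParseState.potential_add_le h1 hbar hα) M f s₀ false
  exact le_trans (by linarith) h

/-- Poisson weights. -/
noncomputable def poissonWeight (r : ℝ) (n : ℕ) : ℝ := Real.exp (-r) * r ^ n / n.factorial

theorem poissonWeight_nonneg {r : ℝ} (hr : 0 ≤ r) (n : ℕ) : 0 ≤ poissonWeight r n := by
  unfold poissonWeight; positivity

theorem hasSum_poissonWeight (r : ℝ) : HasSum (poissonWeight r) 1 := by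
  have h := (NormedSpace.expSeries_div_hasSum_exp r).mul_left (Real.exp (-r))
  rw [← Real.exp_eq_exp_ℝ, ← Real.exp_add, neg_add_cancel, Real.exp_zero] at h
  refine h.congr_fun ?_
  intro n
  simp only [poissonWeight]; ring

/-- Thinning of a Poisson law. -/
theorem hasSum_poissonWeight_thin (r d : ℝ) (D : ℕ) :
    HasSum (fun t => poissonWeight r t * (t.choose D * (1 - d) ^ D * d ^ (t - D)))
      (poissonWeight (r * (1 - d)) D) := by
  rw [← hasSum_nat_add_iff' D, Finset.sum_eq_zero fun t ht => by
    rw [Nat.choose_eq_zero_of_lt (mem_range.1 ht)]; simp, sub_zero]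
  have h := (NormedSpace.expSeries_div_hasSum_exp (r * d)).mul_left
    (Real.exp (-r) * (r * (1 - d)) ^ D / D.factorial)
  rw [← Real.exp_eq_exp_ℝ] at h
  have h5 : poissonWeight (r * (1 - d)) D =
      Real.exp (-r) * (r * (1 - d)) ^ D / D.factorial * Real.exp (r * d) := by
    rw [poissonWeight, show -(r * (1 - d)) = -r + r * d by ring, Real.exp_add]
    ring
  rw [h5]
  refine h.congr_fun ?_
  · intro s
    have h1 : ((s + D).choose D : ℝ) * D.factorial * s.factorial = (s + D).factorial := by
      have := Nat.add_choose_mul_factorial_mul_factorial s D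
      rw [← this]; push_cast; ring
    have h2 : ((s + D).factorial : ℝ) ≠ 0 := by positivity
    have h3 : (D.factorial : ℝ) ≠ 0 := by positivity
    have h4 : (s.factorial : ℝ) ≠ 0 := by positivity
    simp only [poissonWeight, Nat.add_sub_cancel, mul_pow]
    rw [div_mul_eq_mul_div, div_mul_div_comm, div_eq_div_iff h2 (mul_ne_zero h3 h4), ← h1]
    ring

/-- A Poisson law with the mass beyond `K` moved to `0`. -/
noncomputable def truncPoisson (r : ℝ) (K n : ℕ) : ℝ :=
  poissonWeight r n + if n = 0 then 1 - ∑ t ∈ range (K + 1), poissonWeight r t else 0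

theorem truncPoisson_nonneg {r : ℝ} (hr : 0 ≤ r) (K n : ℕ) : 0 ≤ truncPoisson r K n := by
  have h := sum_le_hasSum (range (K + 1)) (fun i _ => poissonWeight_nonneg hr i)
    (hasSum_poissonWeight r)
  have := poissonWeight_nonneg hr n
  unfold truncPoisson
  split_ifs <;> linarith

theorem sum_truncPoisson_mul (r : ℝ) (K : ℕ) (f : ℕ → ℝ) :
    ∑ t : Fin (K + 1), truncPoisson r K t * f t =
      ∑ t ∈ range (K + 1), poissonWeight r t * f t +
        (1 - ∑ t ∈ range (K + 1), poissonWeight r t) * f 0 := by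
  rw [Fin.sum_univ_eq_sum_range (fun t => truncPoisson r K t * f t)]
  simp [truncPoisson, add_mul, Finset.sum_add_distrib]

theorem sum_truncPoisson (r : ℝ) (K : ℕ) : ∑ t : Fin (K + 1), truncPoisson r K t = 1 := by
  have := sum_truncPoisson_mul r K fun _ => 1
  simp only [mul_one] at this
  rw [this]; ring

theorem sum_truncPoisson_mul_le {r : ℝ} (hr : 0 ≤ r) (K : ℕ) :
    ∑ t : Fin (K + 1), truncPoisson r K t * ((t : ℕ) : ℝ) ≤ r := by
  rw [sum_truncPoisson_mul r K fun t => (t : ℝ), Nat.cast_zero, mul_zero, add_zero,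
    Finset.sum_range_succ', Nat.cast_zero, mul_zero, add_zero]
  have h := sum_le_hasSum (range K) (fun i _ => poissonWeight_nonneg hr i) (hasSum_poissonWeight r)
  calc _ = r * ∑ t ∈ range K, poissonWeight r t := by
        rw [Finset.mul_sum]
        refine Finset.sum_congr rfl fun t _ => ?_
        have h1 : ((t + 1 : ℕ) : ℝ) ≠ 0 := by positivity
        have h2 : (t.factorial : ℝ) ≠ 0 := by positivity
        simp only [poissonWeight, Nat.factorial_succ, Nat.cast_mul]
        field_simp
        ring
    _ ≤ r * 1 := by gcongr
    _ = r := mul_one r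

theorem tendsto_survival_truncPoisson {J : Type*} (p r : J → ℝ) (d : ℝ) (j : J) (D : ℕ) :
    Filter.Tendsto (fun K => survival d (fun a : J × Fin (K + 1) =>
      p a.1 * truncPoisson (r a.1) K a.2) j D) Filter.atTop
      (nhds (p j * poissonWeight (r j * (1 - d)) D)) := by
  have h1 := ((hasSum_poissonWeight_thin (r j) d D).tendsto_sum_nat).comp
    (Filter.tendsto_add_atTop_nat 1)
  have h2 := ((hasSum_poissonWeight (r j)).tendsto_sum_nat).comp (Filter.tendsto_add_atTop_nat 1)
  have h3 := ((h1.add ((h2.const_sub 1).mul_const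
    (((0 : ℕ).choose D * (1 - d) ^ D * d ^ (0 - D) : ℝ))))).const_mul (p j)
  simp only [sub_self, zero_mul, add_zero] at h3
  refine h3.congr fun K => ?_
  simp only [survival, mul_assoc, ← Finset.mul_sum, Function.comp]
  rw [sum_truncPoisson_mul (r j) K fun t => (t.choose D : ℝ) * ((1 - d) ^ D * d ^ (t - D))]

section runExp
variable {J : Type*} [Fintype J] {ρ : J → ℕ → ℝ} {K : ℕ}

theorem runExp_add (F G : J → ℕ → ℝ) :
    runExp ρ K (fun j D => F j D + G j D) = runExp ρ K F + runExp ρ K G := by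
  simp only [runExp, mul_add, Finset.sum_add_distrib]

theorem runExp_const_mul (a : ℝ) (F : J → ℕ → ℝ) :
    runExp ρ K (fun j D => a * F j D) = a * runExp ρ K F := by
  simp only [runExp, Finset.mul_sum]
  exact Finset.sum_congr rfl fun j _ => Finset.sum_congr rfl fun D _ => by ring

theorem goneExp_const_mul (a : ℝ) (F : J → ℝ) :
    goneExp ρ (fun j => a * F j) = a * goneExp ρ F := by
  simp only [goneExp, Finset.mul_sum]
  exact Finset.sum_congr rfl fun j _ => by ring

end runExp

namespace Rewards
variable {J : Type*} [Fintype J]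

/-- The total reward per parsed group, above the levels `σ₀`, `σ₁`, `σ₂`. -/
noncomputable def gain (R : Rewards J) (σ₀ σ₁ σ₂ : ℝ) (K : ℕ) (ρ : J → ℕ → ℝ) : ℝ :=
  aliveExp ρ K (fun a l => R.v₀ a l + σ₀) +
  aliveExp ρ K (fun a D => goneExp ρ fun b => runExp ρ K fun c D' => R.v₁ a b c (D + D') + σ₁) +
  aliveExp ρ K (fun a D => goneExp ρ fun b => runExp ρ K fun c D₁ => goneExp ρ fun b' =>
    runExp ρ K fun c' D₂ => R.v₂ a b c b' c' (D + D₁ + D₂) + σ₂) +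
  ρ R.z 0 * aliveExp ρ K (fun a D => ∑ D' ∈ range (K + 1), ρ R.z D' *
    aliveExp ρ K (fun d l => R.γ a (D + D') d l))

/-- The cost per parsed group, in terms of the probability `p₀` that a run is deleted. -/
noncomputable def cost (σ₀ σ₁ σ₂ κ c p₀ : ℝ) : ℝ :=
  (1 - p₀) * (σ₀ + p₀ * σ₁ + p₀ ^ 2 * σ₂) + c * (1 + p₀) * (1 + p₀ + p₀ ^ 2) +
    p₀ ^ 3 * (3 + κ + (p₀ + c * (1 + p₀)) / (1 - p₀))

open Classical in
theorem aliveExp_pot₁ (R : Rewards J) (ρ : J → ℕ → ℝ) (K : ℕ) (h1 : runExp ρ K (fun _ _ => 1) = 1)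
    (σ₀ σ₁ σ₂ κ c p₀ : ℝ) (hp : (goneExp ρ fun _ => 1) = p₀) (hp1 : p₀ < 1) :
    aliveExp ρ K (fun a D => R.pot₁ ρ K c (-κ - (p₀ + c * (1 + p₀)) / (1 - p₀)) a D) =
      (1 - p₀) * (R.gain σ₀ σ₁ σ₂ K ρ - cost σ₀ σ₁ σ₂ κ c p₀) := by
  set α := -κ - (p₀ + c * (1 + p₀)) / (1 - p₀) with hα
  have hne : 1 - p₀ ≠ 0 := by linarith
  obtain ⟨k₅, hk₅⟩ : ∃ x, x = -(1 - p₀) * σ₂ - c + p₀ * (α - 3 - c) := ⟨_, rfl⟩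
  obtain ⟨k₃, hk₃⟩ : ∃ x, x = -(1 - p₀) * σ₁ - c + p₀ * (k₅ - c) := ⟨_, rfl⟩
  obtain ⟨k₁, hk₁⟩ : ∃ x, x = -(1 - p₀) * σ₀ - c + p₀ * (k₃ - c) := ⟨_, rfl⟩
  have h5 : ∀ a b d b' d' l, R.pot₅ ρ c α a b d b' d' l =
      (1 - p₀) * (R.v₂ a b d b' d' l + σ₂) + k₅ := by
    intro a b d b' d' l
    rw [pot₅, hp, hk₅]; ring
  have h4 : ∀ a b d b' l, R.pot₄ ρ K c α a b d b' l =
      (1 - p₀) * runExp ρ K (fun d' D => R.v₂ a b d b' d' (l + D) + σ₂) + (k₅ - c) := by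
    intro a b d b' l
    simp only [pot₄, h5]
    rw [runExp_add, runExp_const_mul, runExp_const h1]; ring
  have h3 : ∀ a b d l, R.pot₃ ρ K c α a b d l = (1 - p₀) * ((R.v₁ a b d l + σ₁) +
      goneExp ρ (fun b' => runExp ρ K (fun d' D => R.v₂ a b d b' d' (l + D) + σ₂)) +
      if b = R.z ∧ d = R.z then aliveExp ρ K (fun d D => R.γ a l d D) else 0) + k₃ := by
    intro a b d l
    simp only [pot₃, h4]
    rw [goneExp_add, goneExp_const_mul, goneExp_const (k₅ - c), hp]
    rw [hk₃]; split_ifs <;> ring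
  have h2 : ∀ a b l, R.pot₂ ρ K c α a b l = (1 - p₀) *
      (runExp ρ K (fun d D => R.v₁ a b d (l + D) + σ₁) +
      runExp ρ K (fun d D => goneExp ρ fun b' => runExp ρ K fun d' D' =>
        R.v₂ a b d b' d' (l + D + D') + σ₂) +
      runExp ρ K (fun d D => if b = R.z ∧ d = R.z then
        aliveExp ρ K (fun d' D' => R.γ a (l + D) d' D') else 0)) + (k₃ - c) := by
    intro a b l
    simp only [pot₂, h3]
    rw [runExp_add, runExp_const_mul, runExp_const h1, runExp_add, runExp_add]; ring
  have hz : ∀ X : ℕ → ℝ, (goneExp ρ fun b => runExp ρ K fun d D =>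
      if b = R.z ∧ d = R.z then X D else 0) = ρ R.z 0 * ∑ D ∈ range (K + 1), ρ R.z D * X D := by
    intro X
    simp only [goneExp, runExp]
    rw [Finset.sum_eq_single R.z (fun b _ hb => by simp [hb]) (by simp),
      Finset.sum_eq_single R.z (fun d _ hd => by simp [hd]) (by simp)]
    simp
  have hpot : ∀ a l, R.pot₁ ρ K c α a l = (1 - p₀) * ((R.v₀ a l + σ₀) +
      (goneExp ρ fun b => runExp ρ K fun d D => R.v₁ a b d (l + D) + σ₁) +
      (goneExp ρ fun b => runExp ρ K fun d D => goneExp ρ fun b' => runExp ρ K fun d' D' =>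
        R.v₂ a b d b' d' (l + D + D') + σ₂) +
      ρ R.z 0 * ∑ D ∈ range (K + 1), ρ R.z D *
        aliveExp ρ K (fun d' D' => R.γ a (l + D) d' D')) + k₁ := by
    intro a l
    simp only [pot₁, h2]
    rw [goneExp_add, goneExp_const_mul, goneExp_const (k₃ - c), goneExp_add, goneExp_add, hz, hp, hk₁]
    ring
  simp only [hpot]
  rw [aliveExp_add, aliveExp_const_mul, aliveExp_const h1, hp, aliveExp_add, aliveExp_add,
    aliveExp_add, aliveExp_const_mul (ρ R.z 0), gain, cost]
  rw [hk₁, hk₃, hk₅, hα]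
  field_simp
  ring

end Rewards

section support
variable {J : Type*} [Fintype J] {ρ : J → ℕ → ℝ} {K N : ℕ}

theorem aliveExp_eq_of_support (hK : N ≤ K) {F : J → ℕ → ℝ} (hF : ∀ j D, N < D → F j D = 0) :
    aliveExp ρ K F = aliveExp ρ N F :=
  Finset.sum_congr rfl fun j _ => (Finset.sum_subset (range_subset_range.2 hK) fun D _ hD => by
    rw [hF j (D + 1) (by rw [mem_range] at hD; omega), mul_zero]).symm

theorem runExp_eq_of_support (hK : N ≤ K) {F : J → ℕ → ℝ} (hF : ∀ j D, N < D → F j D = 0) :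
    runExp ρ K F = runExp ρ N F := by
  rw [runExp_eq, runExp_eq, aliveExp_eq_of_support hK hF]

theorem exists_forall_le_of_support {ι : Type*} [Finite ι] (f : ι → ℕ → ℝ) (a : ℝ)
    (hf : ∀ i l, N < l → f i l = a) : ∃ B, 0 ≤ B ∧ ∀ i l, f i l ≤ B := by
  have := Fintype.ofFinite ι
  refine ⟨|a| + ∑ i, ∑ l ∈ range (N + 1), |f i l|, by positivity, fun i l => ?_⟩
  by_cases hl : N < l
  · rw [hf i l hl]
    exact (le_abs_self a).trans (le_add_of_nonneg_right (by positivity))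
  · refine (le_abs_self _).trans (le_trans ?_ (le_add_of_nonneg_left (abs_nonneg a)))
    refine le_trans ?_ (Finset.single_le_sum (f := fun i => ∑ l ∈ range (N + 1), |f i l|)
      (fun i _ => by positivity) (mem_univ i))
    exact Finset.single_le_sum (f := fun l => |f i l|) (fun l _ => abs_nonneg _)
      (mem_range.2 (by omega))

end support

namespace Rewards
variable {J : Type*} [Fintype J] {R : Rewards J} {σ₀ σ₁ σ₂ : ℝ} {N : ℕ}

theorem gain_eq_of_support {K : ℕ} (hK : N ≤ K) (h₀ : ∀ a l, N < l → R.v₀ a l = -σ₀)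
    (h₁ : ∀ a b d l, N < l → R.v₁ a b d l = -σ₁)
    (h₂ : ∀ a b d b' d' l, N < l → R.v₂ a b d b' d' l = -σ₂)
    (hγ : ∀ a l d l', N < l ∨ N < l' → R.γ a l d l' = 0) (ρ : J → ℕ → ℝ) :
    R.gain σ₀ σ₁ σ₂ K ρ = R.gain σ₀ σ₁ σ₂ N ρ := by
  have hrun0 : ∀ F : J → ℕ → ℝ, (∀ j D, F j D = 0) → ∀ K, runExp ρ K F = 0 := fun F hF K => by
    simp [runExp, hF]
  have hgone0 : ∀ F : J → ℝ, (∀ j, F j = 0) → goneExp ρ F = 0 := fun F hF => by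
    simp [goneExp, hF]
  have halive0 : ∀ F : J → ℕ → ℝ, (∀ j D, F j D = 0) → ∀ K, aliveExp ρ K F = 0 := fun F hF K => by
    simp [aliveExp, hF]
  have e₁ : ∀ a b D, runExp ρ K (fun c D' => R.v₁ a b c (D + D') + σ₁) =
      runExp ρ N (fun c D' => R.v₁ a b c (D + D') + σ₁) := fun a b D =>
    runExp_eq_of_support hK fun c D' hD => by rw [h₁ _ _ _ _ (by omega)]; ring
  have e₂ : ∀ a b c b' D, runExp ρ K (fun c' D' => R.v₂ a b c b' c' (D + D') + σ₂) =
      runExp ρ N (fun c' D' => R.v₂ a b c b' c' (D + D') + σ₂) := fun a b c b' D =>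
    runExp_eq_of_support hK fun c' D' hD => by rw [h₂ _ _ _ _ _ _ (by omega)]; ring
  have z₂ : ∀ a b c b' D, N < D → runExp ρ N (fun c' D' => R.v₂ a b c b' c' (D + D') + σ₂) = 0 :=
    fun a b c b' D hD => hrun0 _ (fun c' D' => by rw [h₂ _ _ _ _ _ _ (by omega)]; ring) N
  have e₃ : ∀ a b D, runExp ρ K (fun c D₁ => goneExp ρ fun b' =>
      runExp ρ N fun c' D₂ => R.v₂ a b c b' c' (D + D₁ + D₂) + σ₂) =
      runExp ρ N (fun c D₁ => goneExp ρ fun b' =>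
      runExp ρ N fun c' D₂ => R.v₂ a b c b' c' (D + D₁ + D₂) + σ₂) := fun a b D =>
    runExp_eq_of_support hK fun c D₁ hD => hgone0 _ fun b' => z₂ _ _ _ _ _ (by omega)
  have e₄ : ∀ a D, aliveExp ρ K (fun d l => R.γ a D d l) = aliveExp ρ N (fun d l => R.γ a D d l) :=
    fun a D => aliveExp_eq_of_support hK fun d l hl => hγ _ _ _ _ (Or.inr hl)
  have z₄ : ∀ a D, N < D → aliveExp ρ N (fun d l => R.γ a D d l) = 0 := fun a D hD =>
    halive0 _ (fun d l => hγ _ _ _ _ (Or.inl hD)) N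
  have e₅ : ∀ a D, ∑ D' ∈ range (K + 1), ρ R.z D' * aliveExp ρ N (fun d l => R.γ a (D + D') d l) =
      ∑ D' ∈ range (N + 1), ρ R.z D' * aliveExp ρ N (fun d l => R.γ a (D + D') d l) := fun a D =>
    (Finset.sum_subset (range_subset_range.2 (by omega)) fun D' _ hD => by
      rw [z₄ _ _ (by rw [mem_range] at hD; omega), mul_zero]).symm
  simp only [gain, e₁, e₂, e₃, e₄, e₅]
  congr 1
  · congr 1
    · congr 1
      · exact aliveExp_eq_of_support hK fun a D hD => by rw [h₀ _ _ hD]; ring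
      · exact aliveExp_eq_of_support hK fun a D hD => hgone0 _ fun b => hrun0 _ (fun c D' => by
          rw [h₁ _ _ _ _ (by omega)]; ring) N
    · exact aliveExp_eq_of_support hK fun a D hD => hgone0 _ fun b => hrun0 _ (fun c D' =>
        hgone0 _ fun b' => z₂ _ _ _ _ _ (by omega)) N
  · congr 1
    exact aliveExp_eq_of_support hK fun a D hD => Finset.sum_eq_zero fun D' _ => by
      rw [z₄ _ _ (by omega), mul_zero]

theorem continuous_gain (R : Rewards J) (σ₀ σ₁ σ₂ : ℝ) (N : ℕ) :
    Continuous fun ρ : J → ℕ → ℝ => R.gain σ₀ σ₁ σ₂ N ρ := by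
  unfold gain aliveExp goneExp runExp
  fun_prop

theorem continuousAt_cost (σ₀ σ₁ σ₂ κ c : ℝ) {p₀ : ℝ} (hp : p₀ < 1) :
    ContinuousAt (cost σ₀ σ₁ σ₂ κ c) p₀ := by
  have : (1 - p₀) ≠ 0 := by linarith
  unfold cost
  fun_prop (disch := assumption)

end Rewards

/-- A positive drift at the Poisson law yields a linear lower bound for the capacities. -/
theorem linear_le_Cdel_of_poisson {J : Type*} [Fintype J] [Nonempty J] {d : ℝ} (hd₁ : 0 ≤ d)
    (hd₂ : d < 1) {p Λ : J → ℝ} (hp : ∀ j, 0 < p j) (hp1 : ∑ j, p j = 1) (hΛ : ∀ j, 0 ≤ Λ j)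
    {R : Rewards J} {g : List J → ℕ → ℝ} {η κ c B σ₀ σ₁ σ₂ : ℝ} {N : ℕ} (hc : 0 ≤ c) (hκ0 : 0 ≤ κ)
    (hg : ∀ u l, 0 < g u l) (hη : 0 < η) (hη1 : η ≤ 1)
    (hK : ∀ T l, ∑ m ∈ range T, listExp p (2 * m + 1) (fun u => g u l) ≤ 1 - η)
    (hv₀ : ∀ a l, R.v₀ a l ≤ Real.logb 2 (g [a] l))
    (hv₁ : ∀ a b c l, R.v₁ a b c l ≤ Real.logb 2 (g [a, b, c] l))
    (hv₂ : ∀ a b c b' c' l, R.v₂ a b c b' c' l ≤ Real.logb 2 (g [a, b, c, b', c'] l))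
    (hκ : ∀ u l, 7 ≤ u.length → -κ - (u.length / 2 : ℕ) ≤ Real.logb 2 (g u l))
    (hγ : ∀ a l₁ d l₂, R.v₁ a R.z R.z l₁ + R.v₀ d l₂ + R.γ a l₁ d l₂ ≤
      Real.logb 2 (g [a, R.z, R.z] l₁ * g [d] l₂ + g [a] l₁ * g [R.z, R.z, d] l₂))
    (s₀ : ∀ a l, N < l → R.v₀ a l = -σ₀) (s₁ : ∀ a b d l, N < l → R.v₁ a b d l = -σ₁)
    (s₂ : ∀ a b d b' d' l, N < l → R.v₂ a b d b' d' l = -σ₂)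
    (sγ : ∀ a l d l', N < l ∨ N < l' → R.γ a l d l' = 0) (hγB : ∀ a l d l', R.γ a l d l' ≤ B)
    (hpos : Rewards.cost σ₀ σ₁ σ₂ κ c (∑ j, p j * Real.exp (-Λ j)) <
      R.gain σ₀ σ₁ σ₂ N fun j D => p j * poissonWeight (Λ j) D)
    (hp₀ : ∑ j, p j * Real.exp (-Λ j) < 1)
    {τ : ℝ} (hτ : ∑ j, p j * Λ j < τ * (1 - d)) :
    ∃ C', ∀ M n : ℕ, τ * M ≤ n → M * c - C' ≤ Cdel n d := by
  have hd : 0 < 1 - d := by linarith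
  set r : J → ℝ := fun j => Λ j / (1 - d) with hr
  have hr0 : ∀ j, 0 ≤ r j := fun j => div_nonneg (hΛ j) hd.le
  have hrd : ∀ j, r j * (1 - d) = Λ j := fun j => div_mul_cancel₀ _ hd.ne'
  set w : ∀ K : ℕ, J × Fin (K + 1) → ℝ := fun K a => p a.1 * truncPoisson (r a.1) K a.2 with hw
  have hw0 : ∀ K a, 0 ≤ w K a := fun K a => mul_nonneg (hp _).le (truncPoisson_nonneg (hr0 _) _ _)
  have hw1 : ∀ K, ∑ a, w K a = 1 := fun K => by
    simp only [hw, Fintype.sum_prod_type, ← Finset.mul_sum, sum_truncPoisson, mul_one, hp1]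
  have hlim : Filter.Tendsto (fun K => survival d (w K)) Filter.atTop
      (nhds fun j D => p j * poissonWeight (Λ j) D) :=
    tendsto_pi_nhds.2 fun j => tendsto_pi_nhds.2 fun D => by
      have := tendsto_survival_truncPoisson p r d j D
      rwa [hrd] at this
  have hgone : Filter.Tendsto (fun K => goneExp (survival d (w K)) fun _ => 1) Filter.atTop
      (nhds (∑ j, p j * Real.exp (-Λ j))) := by
    have h : Continuous fun ρ : J → ℕ → ℝ => goneExp ρ fun _ => 1 := by
      unfold goneExp; fun_prop
    have := (h.tendsto _).comp hlim
    simpa [goneExp, poissonWeight, Function.comp_def] using this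
  have hgain := ((R.continuous_gain σ₀ σ₁ σ₂ N).tendsto _).comp hlim
  have hcost := (Rewards.continuousAt_cost σ₀ σ₁ σ₂ κ c hp₀).tendsto.comp hgone
  obtain ⟨K, hK1, hK2, hKN⟩ := ((hcost.eventually_lt hgain hpos).and
    ((hgone.eventually_lt_const hp₀).and (Filter.eventually_ge_atTop N))).exists
  simp only [Function.comp] at hK1
  set ρ := survival d (w K)
  set p₀ := goneExp ρ fun _ => 1 with hp₀d
  have hρ1 : runExp ρ K (fun _ _ => 1) = 1 := by
    simp only [runExp, mul_one, ρ, sum_survival, ← Fintype.sum_prod_type', hw1]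
  have hρ : ∀ j D, 0 ≤ ρ j D := fun j D => Finset.sum_nonneg fun t _ =>
    mul_nonneg (hw0 K _) (by positivity)
  have hp0 : 0 ≤ p₀ := goneExp_one_nonneg hρ
  have hq : 0 < 1 - p₀ := by linarith
  obtain ⟨B₀, hB₀, hB₀'⟩ := exists_forall_le_of_support R.v₀ _ s₀
  obtain ⟨B₁, hB₁, hB₁'⟩ := exists_forall_le_of_support
    (fun (i : J × J × J) l => R.v₁ i.1 i.2.1 i.2.2 l) _ fun i l hl => s₁ _ _ _ _ hl
  obtain ⟨B₂, hB₂, hB₂'⟩ := exists_forall_le_of_support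
    (fun (i : J × J × J × J × J) l => R.v₂ i.1 i.2.1 i.2.2.1 i.2.2.2.1 i.2.2.2.2 l) _
    fun i l hl => s₂ _ _ _ _ _ _ hl
  obtain ⟨j₀⟩ := ‹Nonempty J›
  have hfrac : 0 ≤ (p₀ + c * (1 + p₀)) / (1 - p₀) := by positivity
  obtain ⟨C, hC⟩ := exists_le_listExp_parseScore hd₁ hd₂.le (w K) (hw0 K) (hw1 K) (R := R) (g := g)
    (η := η) (κ := κ) (c := c) (B := B₀ + B₁ + B₂ + |B|)
    (α := -κ - (p₀ + c * (1 + p₀)) / (1 - p₀)) hc (by positivity)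
    (fun a l => by linarith [hB₀' a l, abs_nonneg B])
    (fun a b d l => by linarith [hB₁' (a, b, d) l, abs_nonneg B])
    (fun a b d b' d' l => by linarith [hB₂' (a, b, d, b', d') l, abs_nonneg B])
    (fun a l d l' => by linarith [hγB a l d l', le_abs_self B])
    hg hη hη1 hv₀ hv₁ hv₂ hκ hγ (by linarith)
    (by
      have : (1 - p₀) * (-κ - (p₀ + c * (1 + p₀)) / (1 - p₀) + κ) + p₀ + c * (1 + p₀) = 0 := by
        field_simp
        ring
      exact this.le)
    (by
      rw [R.aliveExp_pot₁ ρ K hρ1 σ₀ σ₁ σ₂ κ c p₀ hp₀d.symm hK2,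
        Rewards.gain_eq_of_support hKN s₀ s₁ s₂ sγ]
      exact mul_nonneg hq.le (by linarith)) j₀
  obtain ⟨pm, hpm, hpm'⟩ : ∃ pm, 0 < pm ∧ ∀ j, pm ≤ p j := by
    obtain ⟨j, -, hj⟩ := Finset.exists_min_image univ p ⟨j₀, mem_univ _⟩
    exact ⟨p j, hp j, fun i => hj i (mem_univ i)⟩
  refine linear_le_Cdel hd₁ hd₂.le hpm hpm' hp1 (ω := fun j t => truncPoisson (r j) K t)
    (fun j t => truncPoisson_nonneg (hr0 j) K t) (fun j => sum_truncPoisson (r j) K)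
    (fun u l => (hg u l).le) hη hη1 hK rfl ?_ j₀ c C hC
  rw [Fintype.sum_prod_type]
  calc _ ≤ ∑ j, p j * r j := Finset.sum_le_sum fun j _ => by
        simp only [mul_assoc]
        rw [← Finset.mul_sum]
        exact mul_le_mul_of_nonneg_left (sum_truncPoisson_mul_le (hr0 j) K) (hp j).le
    _ = (∑ j, p j * Λ j) / (1 - d) := by
        rw [Finset.sum_div]
        exact Finset.sum_congr rfl fun j _ => by rw [hr]; ring
    _ < τ := (div_lt_iff₀ hd).2 hτ

theorem div_le_of_linear_le {u : ℕ → ℝ} {L τ c C : ℝ} (hτ : 0 < τ)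
    (h : ∀ M n : ℕ, τ * M ≤ n → M * c - C ≤ u n)
    (hL : Filter.Tendsto (fun n : ℕ => u n / n) Filter.atTop (nhds L)) : c / τ ≤ L := by
  have h1 : Filter.Tendsto (fun M : ℕ => ⌈τ * M⌉₊) Filter.atTop Filter.atTop :=
    tendsto_nat_ceil_atTop.comp (tendsto_natCast_atTop_atTop.const_mul_atTop hτ)
  have h2 : Filter.Tendsto (fun M : ℕ => (⌈τ * M⌉₊ : ℝ) / M) Filter.atTop (nhds τ) :=
    (tendsto_nat_ceil_mul_div_atTop hτ.le).comp tendsto_natCast_atTop_atTop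
  have h3 : Filter.Tendsto (fun M : ℕ => C / (M : ℝ)) Filter.atTop (nhds 0) :=
    tendsto_const_nhds.div_atTop tendsto_natCast_atTop_atTop
  have h4 := (h3.const_sub c)
  have h5 := (hL.comp h1).mul h2
  have h6 : c - 0 ≤ L * τ := by
    refine le_of_tendsto_of_tendsto h4 h5 ?_
    filter_upwards [Filter.eventually_gt_atTop 0] with M hM
    have hM' : (0 : ℝ) < M := Nat.cast_pos.2 hM
    have hn : (0 : ℝ) < ⌈τ * M⌉₊ := Nat.cast_pos.2 (Nat.ceil_pos.2 (by positivity))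
    have := h M _ (Nat.le_ceil (τ * M))
    simp only [Function.comp]
    rw [div_mul_div_cancel₀ hn.ne', le_div_iff₀ hM', sub_mul, div_mul_cancel₀ _ hM'.ne']
    linarith
  rw [div_le_iff₀ hτ]
  linarith

theorem poissonWeight_add (r s : ℝ) (n : ℕ) :
    poissonWeight (r + s) n = ∑ i ∈ antidiagonal n, poissonWeight r i.1 * poissonWeight s i.2 := by
  have hn : (n.factorial : ℝ) ≠ 0 := by positivity
  rw [poissonWeight, (Commute.all r s).add_pow', neg_add, Real.exp_add, mul_sum, sum_div]
  refine sum_congr rfl fun i hi => ?_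
  have h := Nat.add_choose_mul_factorial_mul_factorial i.2 i.1
  rw [add_comm, mem_antidiagonal.1 hi, mul_right_comm] at h
  have h1 : (i.1.factorial : ℝ) ≠ 0 := by positivity
  have h2 : (i.2.factorial : ℝ) ≠ 0 := by positivity
  have h3 : (n.choose i.1 : ℝ) * i.1.factorial * i.2.factorial = n.factorial := by
    exact_mod_cast h
  rw [nsmul_eq_mul, poissonWeight, poissonWeight, ← h3]
  have h4 : (n.choose i.1 : ℝ) ≠ 0 := by
    intro h0; rw [h0] at h3; simp only [zero_mul] at h3; exact hn h3.symm
  field_simp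

/-- Probability that two independent Poisson variables of means `r` and `s` have total `n`, the
first of them being nonzero. -/
noncomputable def burstWeight (r s : ℝ) (n : ℕ) : ℝ :=
  poissonWeight (r + s) n - Real.exp (-r) * poissonWeight s n

theorem poissonWeight_zero_right (r : ℝ) : poissonWeight r 0 = Real.exp (-r) := by
  simp [poissonWeight]

theorem burstWeight_zero_zero (r : ℝ) : burstWeight r 0 0 = 0 := by
  simp [burstWeight, poissonWeight_zero_right]

theorem burstWeight_zero_succ (r : ℝ) (n : ℕ) :
    burstWeight r 0 (n + 1) = poissonWeight r (n + 1) := by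
  simp [burstWeight, poissonWeight]

theorem burstWeight_eq (r s : ℝ) (n : ℕ) :
    burstWeight r s n = Real.exp (-(r + s)) * ((r + s) ^ n - s ^ n) / n.factorial := by
  rw [burstWeight, poissonWeight, poissonWeight, neg_add, Real.exp_add]
  ring

theorem burstWeight_nonneg {r s : ℝ} (hr : 0 ≤ r) (hs : 0 ≤ s) (n : ℕ) : 0 ≤ burstWeight r s n := by
  rw [burstWeight_eq]
  have : s ^ n ≤ (r + s) ^ n := by gcongr; linarith
  have := sub_nonneg.2 this
  positivity

theorem burstWeight_add (r s t : ℝ) (n : ℕ) :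
    burstWeight r (s + t) n = ∑ i ∈ antidiagonal n, burstWeight r s i.1 * poissonWeight t i.2 := by
  simp only [burstWeight, sub_mul, Finset.sum_sub_distrib, mul_assoc, ← mul_sum, ← poissonWeight_add]
  rw [← add_assoc]

/-- A double sum over a finite range of a function of the sum of the indices. -/
theorem sum_range_sum_range_add {N : ℕ} (a b F : ℕ → ℝ) (hF : ∀ l, N < l → F l = 0) :
    ∑ i ∈ range (N + 1), a i * ∑ j ∈ range (N + 1), b j * F (i + j) =
      ∑ l ∈ range (N + 1), (∑ i ∈ antidiagonal l, a i.1 * b i.2) * F l := by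
  calc _ = ∑ i ∈ range (N + 1), ∑ j ∈ range (N + 1 - i), a i * b j * F (i + j) := by
        refine sum_congr rfl fun i hi => ?_
        rw [mul_sum, ← sum_subset (range_subset_range.2 (Nat.sub_le (N + 1) i))]
        · exact sum_congr rfl fun j _ => (mul_assoc _ _ _).symm
        · intro j _ hj
          rw [mem_range] at hj
          rw [hF _ (by omega), mul_zero, mul_zero]
    _ = ∑ l ∈ range (N + 1), ∑ i ∈ range (l + 1), a i * b (l - i) * F (i + (l - i)) :=
        (sum_range_diag_flip (N + 1) fun i j => a i * b j * F (i + j)).symm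
    _ = _ := by
        refine sum_congr rfl fun l _ => ?_
        rw [Nat.sum_antidiagonal_eq_sum_range_succ fun i j => a i * b j, sum_mul]
        refine sum_congr rfl fun i hi => ?_
        rw [mem_range] at hi
        rw [Nat.add_sub_cancel' (by omega)]

theorem sum_burstWeight_mul_sum {N : ℕ} (r s t : ℝ) (F : ℕ → ℝ) (hF : ∀ l, N < l → F l = 0) :
    ∑ i ∈ range (N + 1), burstWeight r s i * ∑ j ∈ range (N + 1), poissonWeight t j * F (i + j) =
      ∑ l ∈ range (N + 1), burstWeight r (s + t) l * F l := by
  simp only [sum_range_sum_range_add _ _ F hF, burstWeight_add]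

section poisson
variable {J : Type*} [Fintype J] {p Λ : J → ℝ} {N : ℕ}

/-- The law of a label together with a Poisson number of surviving bits. -/
noncomputable def poissonLaw (p Λ : J → ℝ) (j : J) (D : ℕ) : ℝ := p j * poissonWeight (Λ j) D

theorem aliveExp_poissonLaw (F : J → ℕ → ℝ) :
    aliveExp (poissonLaw p Λ) N F =
      ∑ a, p a * ∑ l ∈ range (N + 1), burstWeight (Λ a) 0 l * F a l := by
  refine sum_congr rfl fun a _ => ?_
  rw [sum_range_succ', burstWeight_zero_zero, zero_mul, add_zero, mul_sum]
  exact sum_congr rfl fun D _ => by rw [burstWeight_zero_succ, poissonLaw]; ring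

theorem runExp_poissonLaw (F : J → ℕ → ℝ) :
    runExp (poissonLaw p Λ) N F =
      ∑ a, p a * ∑ l ∈ range (N + 1), poissonWeight (Λ a) l * F a l :=
  sum_congr rfl fun a _ => by rw [mul_sum]; exact sum_congr rfl fun D _ => mul_assoc _ _ _

theorem goneExp_poissonLaw (F : J → ℝ) :
    goneExp (poissonLaw p Λ) F = ∑ b, p b * Real.exp (-Λ b) * F b := by
  simp only [goneExp, poissonLaw, poissonWeight_zero_right]

theorem sum_mul_sum_swap {ι κ : Type*} (s : Finset ι) (t : Finset κ) (a : ι → ℝ) (b : κ → ℝ)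
    (f : ι → κ → ℝ) :
    ∑ i ∈ s, a i * ∑ j ∈ t, b j * f i j = ∑ j ∈ t, b j * ∑ i ∈ s, a i * f i j := by
  simp only [mul_sum]
  rw [sum_comm]
  exact sum_congr rfl fun j _ => sum_congr rfl fun i _ => mul_left_comm _ _ _

theorem sum_burstWeight_mul_goneExp (r s : ℝ) (F : J → J → ℕ → ℝ)
    (hF : ∀ b c l, N < l → F b c l = 0) :
    ∑ D ∈ range (N + 1), burstWeight r s D * goneExp (poissonLaw p Λ) (fun b =>
        runExp (poissonLaw p Λ) N fun c D' => F b c (D + D')) =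
      ∑ b, p b * Real.exp (-Λ b) * ∑ c, p c *
        ∑ l ∈ range (N + 1), burstWeight r (s + Λ c) l * F b c l := by
  simp only [goneExp_poissonLaw, runExp_poissonLaw]
  rw [sum_mul_sum_swap]
  refine sum_congr rfl fun b _ => ?_
  rw [sum_mul_sum_swap]
  congr 1
  refine sum_congr rfl fun c _ => ?_
  rw [sum_burstWeight_mul_sum _ _ _ _ (hF b c)]

theorem Rewards.gain_poissonLaw {R : Rewards J} {σ₀ σ₁ σ₂ : ℝ}
    (h₁ : ∀ a b c l, N < l → R.v₁ a b c l = -σ₁)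
    (h₂ : ∀ a b c b' c' l, N < l → R.v₂ a b c b' c' l = -σ₂)
    (hγ : ∀ a l d l', N < l ∨ N < l' → R.γ a l d l' = 0) :
    R.gain σ₀ σ₁ σ₂ N (poissonLaw p Λ) =
      ∑ a, p a * ∑ l ∈ range (N + 1), burstWeight (Λ a) 0 l * (R.v₀ a l + σ₀) +
      ∑ a, p a * ∑ b, p b * Real.exp (-Λ b) * ∑ c, p c *
        ∑ l ∈ range (N + 1), burstWeight (Λ a) (Λ c) l * (R.v₁ a b c l + σ₁) +
      ∑ a, p a * ∑ b, p b * Real.exp (-Λ b) * ∑ c, p c *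
        ∑ b', p b' * Real.exp (-Λ b') * ∑ c', p c' *
        ∑ l ∈ range (N + 1), burstWeight (Λ a) (Λ c + Λ c') l * (R.v₂ a b c b' c' l + σ₂) +
      p R.z * Real.exp (-Λ R.z) * ∑ a, p a * (p R.z * ∑ l ∈ range (N + 1),
        burstWeight (Λ a) (Λ R.z) l * ∑ d, p d * ∑ l' ∈ range (N + 1),
          burstWeight (Λ d) 0 l' * R.γ a l d l') := by
  have k₁ : ∀ a b c l, N < l → R.v₁ a b c l + σ₁ = 0 := fun a b c l hl => by rw [h₁ _ _ _ _ hl]; ring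
  have k₂ : ∀ a b c b' c' l, N < l → R.v₂ a b c b' c' l + σ₂ = 0 := fun a b c b' c' l hl => by
    rw [h₂ _ _ _ _ _ _ hl]; ring
  unfold Rewards.gain
  congr 1
  · congr 1
    · congr 1
      · exact aliveExp_poissonLaw _
      · rw [aliveExp_poissonLaw]
        refine sum_congr rfl fun a _ => ?_
        rw [sum_burstWeight_mul_goneExp _ _ (fun b c l => R.v₁ a b c l + σ₁) (k₁ a)]
        simp only [zero_add]
    · rw [aliveExp_poissonLaw]
      refine sum_congr rfl fun a _ => ?_
      rw [sum_burstWeight_mul_goneExp _ _ (fun b c l => goneExp (poissonLaw p Λ) fun b' =>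
        runExp (poissonLaw p Λ) N fun c' D₂ => R.v₂ a b c b' c' (l + D₂) + σ₂)]
      · congr 1
        refine sum_congr rfl fun b _ => ?_
        congr 1
        refine sum_congr rfl fun c _ => ?_
        rw [sum_burstWeight_mul_goneExp _ _ (fun b' c' l => R.v₂ a b c b' c' l + σ₂) (k₂ a b c)]
        simp only [zero_add]
      · intro b c l hl
        have : ∀ b' c' D, R.v₂ a b c b' c' (l + D) + σ₂ = 0 := fun b' c' D =>
          k₂ _ _ _ _ _ _ (by omega)
        simp [goneExp, runExp, this]
  · rw [aliveExp_poissonLaw]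
    simp only [poissonLaw, poissonWeight_zero_right]
    congr 1
    refine sum_congr rfl fun a _ => ?_
    congr 1
    simp only [mul_assoc, ← mul_sum]
    rw [← zero_add (Λ R.z), ← sum_burstWeight_mul_sum, mul_sum]
    · refine sum_congr rfl fun D _ => ?_
      rw [mul_left_comm]
      simp only [zero_add]
      congr 2
      refine sum_congr rfl fun D' _ => ?_
      congr 1
      exact aliveExp_poissonLaw (p := p) (Λ := Λ) _
    · intro l hl
      refine sum_eq_zero fun d _ => ?_
      rw [sum_eq_zero, mul_zero]
      exact fun l' _ => by rw [hγ _ _ _ _ (Or.inl hl), mul_zero]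

end poisson

/-- Three times the mean numbers of surviving bits of the five types of runs. -/
def runLength : Fin 5 → ℕ := ![7, 22, 44, 77, 129]

/-- Frequencies of the five types of runs, out of `1000`. -/
def runShare : Fin 5 → ℕ := ![507, 278, 142, 57, 16]

/-- Sum over the types of runs, weighted by their frequencies. -/
def shareSum (f : ℕ → ℕ) : ℕ :=
  507 * f 7 + 278 * f 22 + 142 * f 44 + 57 * f 77 + 16 * f 129

/-- `f 0 + ⋯ + f (n - 1)`. -/
def sumBelow (f : ℕ → ℕ) : ℕ → ℕ
  | 0 => 0
  | n + 1 => sumBelow f n + f n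

/-- A lower approximation of `2 ^ 34 * burstWeight (n / 3) (m / 3) l`. -/
def cellWeight (n m l : ℕ) : ℕ :=
  2 ^ 34 * 13217669706725904384 ^ (n + m) * ((n + m) ^ l - m ^ l) /
    (2 ^ (64 * (n + m)) * (3 ^ l * l.factorial))

/-- `f x`, with `x` evaluated before being substituted. -/
def eager (x : ℕ) (f : ℕ → ℕ) : ℕ :=
  match x with
  | 0 => f 0
  | n + 1 => f (n + 1)

/-- Binary search for the logarithm of `x ^ 256` among the integers from `e` to `e + 2 ^ b - 1`. -/
def logSearch (x : ℕ) : ℕ → ℕ → ℕ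
  | 0, e => e
  | b + 1, e => eager (e + 2 ^ b) fun e' => bif Nat.ble (2 ^ e') (x ^ 256) then logSearch x b e' else
      logSearch x b e

/-- `256` times a lower approximation of the logarithm of `cellWeight n m l + 1`. -/
def cellLog (n m l : ℕ) : ℕ := eager (cellWeight n m l + 1) fun x => logSearch x 14 0

/-- `256` times an upper approximation of the logarithm of the total weight of the bursts with `l`
surviving bits. -/
def normLog (l : ℕ) : ℕ :=
  [19, 7910, 7978, 7915, 7795, 7687, 7625, 7591, 7554, 7503, 7440, 7377, 7324, 7283, 7251, 7218,
  7179, 7133, 7079, 7021, 6964, 6915, 6875, 6845, 6822, 6802, 6779, 6751, 6717, 6674, 6624,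
  6568, 6508, 6447, 6388, 6336, 6294, 6263, 6244, 6233, 6227, 6222, 6216, 6207, 6194, 6174,
  6149, 6117, 6078, 6033, 5982, 5925, 5862, 5794, 5721, 5644, 5562, 5478, 5392, 5304, 5216,
  5129, 5043, 4960, 4881, 4806, 4736, 4670, 4608, 4550, 4496, 4444, 4394, 4345, 4297, 4250,
  4203, 4156, 4109, 4061, 4014, 3967, 3921, 3874, 3829, 3784, 3740, 3697, 3654, 3612, 3571,
  3529, 3487, 3444, 3400, 3355, 3309, 3261, 3211, 3160, 3106].getD l 0

/-- `256` times the logarithmic score of a burst, up to an additive constant. -/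
def cellGain (n m l : ℕ) : ℕ := cellLog n m l + 8192 - normLog l

/-- Approximations of `2 ^ 14 * exp (-n / 3)`, where `n` is a run length. -/
def goneWeight (n : ℕ) : ℕ := if n = 7 then 1589 else if n = 22 then 11 else 1

/-- `256` times a lower approximation of the logarithm of `goneWeight n`. -/
def goneLog (n : ℕ) : ℕ := if n = 7 then 2722 else if n = 22 then 885 else 0

/-- `256` times a lower approximation of the logarithm of `1 + 2 ^ ((k - 10) / 2)`. -/
def mergeLog (k : ℕ) : ℕ :=
  [0, 15, 22, 31, 43, 60, 82, 111, 149, 197, 256, 325, 405, 495, 594, 700, 811, 927, 1046, 1167,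
  1291].getD k 0

/-- Level of a burst followed by an ambiguous run, in steps of half a bit. -/
def leftLevel (n l : ℕ) : ℕ := (cellLog n 0 l + 2560 - cellLog n 7 l) / 128

/-- Level of a burst preceded by an ambiguous run, in steps of half a bit. -/
def rightLevel (n l : ℕ) : ℕ := (cellLog n 0 l + 2560 - cellLog 7 n l) / 128 + 1

/-- `256` times the gain coming from an ambiguous run, in terms of the levels on both sides. -/
def mergeGain (i j : ℕ) : ℕ := if i = 0 then 0 else mergeLog (min (i + 10 - j) 20)

/-- Lower bounds for the mean of `mergeGain i` over the levels on the right. -/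
def meanMergeGain (i : ℕ) : ℕ :=
  [0, 0, 0, 0, 0, 0, 0, 0, 0, 0, 0, 137775266755182, 212734221345843, 342620675670678,
  489752564658360, 712651881536164, 969376203262917, 1296870362693457, 1743193605416908,
  2279252015678004, 2934009499509955, 3723800412856784, 4658668091155108, 5738444824461344,
  6957731320179881, 8314871366825158, 9776147649541671].getD i 0

theorem normLog_le : ∀ l < 101, normLog l ≤ 8192 := by decide +kernel

theorem goneLog_spec : ∀ j, 2 ^ goneLog (runLength j) ≤ goneWeight (runLength j) ^ 256 := by
  decide +kernel

theorem kraft_nat : ∀ l < 101,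
    (((shareSum fun n => cellWeight n 0 l + 1) * 1000 ^ 4 * 2 ^ 28 +
      (shareSum fun n => shareSum fun m => cellWeight n m l + 1) * 1000 ^ 2 * 2 ^ 14 *
        shareSum goneWeight +
      (shareSum fun n => shareSum fun m => shareSum fun m' => cellWeight n (m + m') l + 1) *
        shareSum goneWeight ^ 2) * 2 ^ 13) ^ 256 ≤
      2 ^ normLog l * (1000 ^ 5 * 2 ^ 28 * (2 ^ 13 - 3)) ^ 256 := by
  decide +kernel

theorem single_nat : 138539445524477889 ≤
    sumBelow (fun l => shareSum fun n => cellWeight n 0 l * cellGain n 0 l) 101 := by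
  decide +kernel

theorem double_nat : 141599145104931011474 ≤
    sumBelow (fun l => shareSum fun n => shareSum fun m =>
      cellWeight n m l * cellGain n m l) 101 := by
  decide +kernel

theorem double_mass_nat : 16331826344526130 ≤
    sumBelow (fun l => shareSum fun n => shareSum fun m => cellWeight n m l) 101 := by
  decide +kernel

theorem triple_nat : 145494920331872645354755 ≤
    sumBelow (fun l => shareSum fun n => shareSum fun m => shareSum fun m' =>
      cellWeight n (m + m') l * cellGain n (m + m') l) 101 := by
  decide +kernel

theorem triple_mass_nat : 16327686893995724629 ≤
    sumBelow (fun l => shareSum fun n => shareSum fun m => shareSum fun m' =>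
      cellWeight n (m + m') l) 101 := by
  decide +kernel

theorem mergeLog_spec : ∀ k < 21, k = 0 ∨ ∃ b < 2 ^ 26, b ^ 2 ≤ 2 ^ (30 + k) ∧
    2 ^ (mergeLog k + 5120) ≤ (2 ^ 20 + b) ^ 256 := by
  have : ∀ k < 21, k = 0 ∨ Nat.sqrt (2 ^ (30 + k)) < 2 ^ 26 ∧
      2 ^ (mergeLog k + 5120) ≤ (2 ^ 20 + Nat.sqrt (2 ^ (30 + k))) ^ 256 := by decide +kernel
  exact fun k hk => (this k hk).imp_right fun h => ⟨_, h.1, Nat.sqrt_le' _, h.2⟩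

theorem meanMergeGain_le : ∀ i < 27, meanMergeGain i ≤
    sumBelow (fun l => shareSum fun n => cellWeight n 0 l * mergeGain i (rightLevel n l)) 101 := by
  decide +kernel

theorem merge_nat : 35170684050143272827326286385 ≤
    sumBelow (fun l => shareSum fun n => cellWeight n 7 l * meanMergeGain (leftLevel n l)) 101 := by
  decide +kernel

/-- Probabilities of the types of runs. -/
noncomputable def share (j : Fin 5) : ℝ := runShare j / 1000

/-- Mean numbers of surviving bits of the types of runs. -/
noncomputable def meanLength (j : Fin 5) : ℝ := runLength j / 3

theorem share_pos (j : Fin 5) : 0 < share j := by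
  fin_cases j <;> norm_num [share, runShare]

theorem sum_share : ∑ j, share j = 1 := by
  simp only [share, Fin.sum_univ_five, show runShare 0 = 507 from rfl,
    show runShare 1 = 278 from rfl, show runShare 2 = 142 from rfl, show runShare 3 = 57 from rfl,
    show runShare 4 = 16 from rfl]
  norm_num

theorem meanLength_nonneg (j : Fin 5) : 0 ≤ meanLength j := by unfold meanLength; positivity

theorem cast_shareSum (f : ℕ → ℕ) :
    (shareSum f : ℝ) = 1000 * ∑ j, share j * f (runLength j) := by
  simp only [shareSum, share, Fin.sum_univ_five, runLength, runShare, Matrix.cons_val]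
  push_cast
  ring

theorem cast_sumBelow (f : ℕ → ℕ) (n : ℕ) :
    (sumBelow f n : ℝ) = ∑ l ∈ range n, (f l : ℝ) := by
  induction n with
  | zero => simp [sumBelow]
  | succ n ih => rw [sumBelow, Nat.cast_add, ih, sum_range_succ]

theorem eager_eq (x : ℕ) (f : ℕ → ℕ) : eager x f = f x := by cases x <;> rfl

theorem two_pow_logSearch_le (x b e : ℕ) (h : 2 ^ e ≤ x ^ 256) :
    2 ^ logSearch x b e ≤ x ^ 256 := by
  induction b generalizing e with
  | zero => exact h
  | succ b ih =>
    rw [logSearch, eager_eq]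
    cases h' : Nat.ble (2 ^ (e + 2 ^ b)) (x ^ 256)
    · exact ih e h
    · exact ih _ (Nat.le_of_ble_eq_true h')

theorem two_pow_cellLog_le (n m l : ℕ) : 2 ^ cellLog n m l ≤ (cellWeight n m l + 1) ^ 256 := by
  rw [cellLog, eager_eq]
  exact two_pow_logSearch_le _ _ _ (by simpa using Nat.one_le_pow _ _ (Nat.succ_pos _))

theorem two_rpow_div_le {e x : ℕ} (h : 2 ^ e ≤ x ^ 256) : (2 : ℝ) ^ ((e : ℝ) / 256) ≤ x := by
  have h' : (2 : ℝ) ^ e ≤ (x : ℝ) ^ 256 := by exact_mod_cast h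
  refine le_of_pow_le_pow_left₀ (n := 256) (by norm_num) (Nat.cast_nonneg x) ?_
  rw [← Real.rpow_natCast, ← Real.rpow_mul (by norm_num)]
  rw [show (e : ℝ) / 256 * (256 : ℕ) = e by push_cast; ring, Real.rpow_natCast]
  exact h'

theorem exp_neg_third_pow (n : ℕ) : Real.exp (-(n / 3 : ℝ)) = Real.exp (-(1 / 3)) ^ n := by
  rw [← Real.exp_nat_mul]; congr 1; ring

theorem le_exp_neg_third : (13217669706725904384 / 2 ^ 64 : ℝ) ≤ Real.exp (-(1 / 3)) := by
  refine le_of_pow_le_pow_left₀ (n := 3) (by norm_num) (Real.exp_pos _).le ?_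
  rw [← Real.exp_nat_mul, show ((3 : ℕ) : ℝ) * -(1 / 3) = -1 by norm_num, Real.exp_neg]
  rw [le_inv_comm₀ (by positivity) (Real.exp_pos _)]
  exact Real.exp_one_lt_d9.le.trans (by norm_num)

theorem exp_neg_third_le : Real.exp (-(1 / 3)) ≤ 13217669707212187648 / 2 ^ 64 := by
  refine le_of_pow_le_pow_left₀ (n := 3) (by norm_num) (by norm_num) ?_
  rw [← Real.exp_nat_mul, show ((3 : ℕ) : ℝ) * -(1 / 3) = -1 by norm_num, Real.exp_neg]
  rw [inv_le_comm₀ (Real.exp_pos _) (by positivity)]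
  exact le_trans (by norm_num) Real.exp_one_gt_d9.le

theorem cellWeight_le (n m l : ℕ) :
    (cellWeight n m l : ℝ) / 2 ^ 34 ≤ burstWeight (n / 3) (m / 3) l := by
  have h1 : m ^ l ≤ (n + m) ^ l := Nat.pow_le_pow_left (by omega) l
  have h2 : (cellWeight n m l : ℝ) ≤ 2 ^ 34 * 13217669706725904384 ^ (n + m) *
      ((n + m) ^ l - m ^ l) / (2 ^ (64 * (n + m)) * (3 ^ l * l.factorial)) := by
    refine Nat.cast_div_le.trans (le_of_eq ?_)
    rw [Nat.cast_mul, Nat.cast_sub h1]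
    push_cast
    norm_num
  have h3 : (13217669706725904384 / 2 ^ 64 : ℝ) ^ (n + m) ≤ Real.exp (-((n / 3 : ℝ) + m / 3)) := by
    rw [show (n / 3 : ℝ) + m / 3 = ((n + m : ℕ) : ℝ) / 3 by push_cast; ring, exp_neg_third_pow]
    exact pow_le_pow_left₀ (by norm_num) le_exp_neg_third _
  have h4 : (0 : ℝ) ≤ (n + m) ^ l - m ^ l := by
    rw [sub_nonneg]; exact_mod_cast h1
  rw [burstWeight_eq, div_le_iff₀ (by positivity)]
  refine h2.trans ?_
  calc _ = (13217669706725904384 / 2 ^ 64 : ℝ) ^ (n + m) *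
        (((n + m) ^ l - m ^ l) / (3 ^ l * l.factorial)) * 2 ^ 34 := by
        rw [div_pow, ← pow_mul]; field_simp
    _ ≤ Real.exp (-((n / 3 : ℝ) + m / 3)) *
        (((n + m) ^ l - m ^ l) / (3 ^ l * l.factorial)) * 2 ^ 34 := by gcongr
    _ = _ := by
        rw [← add_div, div_pow, div_pow]
        field_simp

theorem cast_cellGain {l : ℕ} (hl : l ≤ 100) (n m : ℕ) :
    (cellGain n m l : ℝ) = cellLog n m l + 8192 - normLog l := by
  rw [cellGain, Nat.cast_sub ((normLog_le l (by omega)).trans (Nat.le_add_left _ _))]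
  push_cast
  ring

/-- Rewards of the scoring rule: the logarithmic scores of the groups of runs. -/
noncomputable def cellRewards : Rewards (Fin 5) where
  v₀ a l := (if l ≤ 100 then cellGain (runLength a) 0 l else 0 : ℕ) / 256 - 32
  v₁ a b c l := (if l ≤ 100 then cellGain (runLength a) (runLength c) l + goneLog (runLength b)
    else 0 : ℕ) / 256 - 46
  v₂ a b c b' c' l := (if l ≤ 100 then cellGain (runLength a) (runLength c + runLength c') l +
    goneLog (runLength b) + goneLog (runLength b') else 0 : ℕ) / 256 - 60
  γ a l d l' := (if l ≤ 100 ∧ l' ≤ 100 then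
    mergeGain (leftLevel (runLength a) l) (rightLevel (runLength d) l') else 0 : ℕ) / 256
  z := 0

/-- Weights of the groups of runs with a given number of surviving bits. -/
noncomputable def groupWeight : List (Fin 5) → ℕ → ℝ
  | [a], l => 2 ^ cellRewards.v₀ a l
  | [a, b, c], l => 2 ^ cellRewards.v₁ a b c l
  | [a, b, c, b', c'], l => 2 ^ cellRewards.v₂ a b c b' c' l
  | u, _ => 2 ^ (-10 - (u.length / 2 : ℕ) : ℝ)

theorem groupWeight_pos (u : List (Fin 5)) (l : ℕ) : 0 < groupWeight u l := by
  unfold groupWeight; split <;> positivity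

theorem groupWeight_of_seven_le {u : List (Fin 5)} (hu : 7 ≤ u.length) (l : ℕ) :
    groupWeight u l = 2 ^ (-10 - (u.length / 2 : ℕ) : ℝ) := by
  unfold groupWeight
  split
  · simp at hu
  · simp at hu
  · simp at hu
  · rfl

theorem goneLog_le (j : Fin 5) :
    (2 : ℝ) ^ ((goneLog (runLength j) : ℝ) / 256) ≤ goneWeight (runLength j) :=
  two_rpow_div_le (goneLog_spec j)

theorem cellLog_le (n m l : ℕ) :
    (2 : ℝ) ^ ((cellLog n m l : ℝ) / 256) ≤ (cellWeight n m l + 1 : ℕ) :=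
  two_rpow_div_le (two_pow_cellLog_le n m l)

theorem sum_mul_sum_mul_mul {J : Type*} [Fintype J] (p X G : J → ℝ) :
    ∑ b, p b * ∑ c, p c * (X c * G b) = (∑ b, p b * G b) * ∑ c, p c * X c := by
  rw [sum_mul]
  refine sum_congr rfl fun b _ => ?_
  simp only [mul_sum]
  exact sum_congr rfl fun c _ => by ring

theorem sum_mul_sum_mul_mul₂ {J : Type*} [Fintype J] (p G : J → ℝ) (X : J → J → ℝ) :
    ∑ b, p b * ∑ c, p c * ∑ b', p b' * ∑ c', p c' * (X c c' * G b * G b') =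
      (∑ b, p b * G b) ^ 2 * ∑ c, p c * ∑ c', p c' * X c c' := by
  have h : ∀ b c, ∑ b', p b' * ∑ c', p c' * (X c c' * G b * G b') =
      ((∑ b, p b * G b) * ∑ c', p c' * X c c') * G b := fun b c => by
    rw [sum_mul_sum_mul_mul p (fun c' => X c c' * G b), mul_assoc]
    simp only [sum_mul, mul_assoc]
  simp only [h]
  rw [sum_mul_sum_mul_mul p fun c => (∑ b, p b * G b) * ∑ c', p c' * X c c', sq, mul_assoc]
  congr 1
  rw [mul_sum]
  exact sum_congr rfl fun c _ => by ring

theorem sum_group {J : Type*} [Fintype J] (p W₀ G : J → ℝ) (W₁ : J → J → ℝ)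
    (W₂ : J → J → J → ℝ) (ρ : ℝ) :
    ∑ a, p a * (W₀ a / ρ) + ∑ a, p a * ∑ b, p b * ∑ c, p c * (W₁ a c * G b / ρ) +
      ∑ a, p a * ∑ b, p b * ∑ c, p c * ∑ b', p b' * ∑ c', p c' * (W₂ a c c' * G b * G b' / ρ) =
    (∑ a, p a * W₀ a + (∑ a, p a * ∑ c, p c * W₁ a c) * (∑ b, p b * G b) +
      (∑ a, p a * ∑ c, p c * ∑ c', p c' * W₂ a c c') * (∑ b, p b * G b) ^ 2) / ρ := by
  simp only [← mul_div_assoc, ← sum_div, sum_mul_sum_mul_mul₂]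
  simp only [sum_mul_sum_mul_mul]
  rw [← add_div, ← add_div]
  congr 2
  · congr 1
    rw [sum_mul]
    exact sum_congr rfl fun c _ => by ring
  · rw [sum_mul]
    exact sum_congr rfl fun c _ => by ring

section kraft
variable {l : ℕ}

theorem groupWeight_single_le (hl : l ≤ 100) (a : Fin 5) :
    groupWeight [a] l ≤
      (cellWeight (runLength a) 0 l + 1 : ℕ) / 2 ^ ((normLog l : ℝ) / 256) := by
  rw [le_div_iff₀ (by positivity), groupWeight, ← Real.rpow_add (by norm_num)]
  refine le_trans (le_of_eq ?_) (cellLog_le (runLength a) 0 l)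
  congr 1
  simp only [cellRewards, if_pos hl, cast_cellGain hl]
  ring

theorem groupWeight_triple_le (hl : l ≤ 100) (a b c : Fin 5) :
    groupWeight [a, b, c] l ≤ (cellWeight (runLength a) (runLength c) l + 1 : ℕ) *
      (goneWeight (runLength b) / 2 ^ 14) / 2 ^ ((normLog l : ℝ) / 256) := by
  rw [le_div_iff₀ (by positivity), groupWeight, ← Real.rpow_add (by norm_num), ← mul_div_assoc,
    le_div_iff₀ (by positivity), ← Real.rpow_natCast, ← Real.rpow_add (by norm_num)]
  refine le_trans (le_of_eq ?_) (mul_le_mul (cellLog_le (runLength a) (runLength c) l)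
    (goneLog_le b) (by positivity) (by positivity))
  rw [← Real.rpow_add (by norm_num)]
  congr 1
  simp only [cellRewards, if_pos hl, Nat.cast_add, cast_cellGain hl]
  push_cast
  ring

theorem groupWeight_quintuple_le (hl : l ≤ 100) (a b c b' c' : Fin 5) :
    groupWeight [a, b, c, b', c'] l ≤
      (cellWeight (runLength a) (runLength c + runLength c') l + 1 : ℕ) *
      (goneWeight (runLength b) / 2 ^ 14) * (goneWeight (runLength b') / 2 ^ 14) /
      2 ^ ((normLog l : ℝ) / 256) := by
  rw [le_div_iff₀ (by positivity), groupWeight, ← Real.rpow_add (by norm_num), ← mul_div_assoc,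
    ← mul_div_assoc, div_mul_eq_mul_div, div_div, ← pow_add,
    le_div_iff₀ (by positivity), ← Real.rpow_natCast, ← Real.rpow_add (by norm_num)]
  refine le_trans (le_of_eq ?_) (mul_le_mul (mul_le_mul
    (cellLog_le (runLength a) (runLength c + runLength c') l)
    (goneLog_le b) (by positivity) (by positivity)) (goneLog_le b')
    (by positivity) (by positivity))
  rw [← Real.rpow_add (by norm_num), ← Real.rpow_add (by norm_num)]
  congr 1
  simp only [cellRewards, if_pos hl, Nat.cast_add, cast_cellGain hl]
  push_cast
  ring

theorem le_two_rpow_mul {x y e : ℕ} (h : x ^ 256 ≤ 2 ^ e * y ^ 256) :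
    (x : ℝ) ≤ 2 ^ ((e : ℝ) / 256) * y := by
  refine le_of_pow_le_pow_left₀ (n := 256) (by norm_num) (by positivity) ?_
  rw [mul_pow, ← Real.rpow_natCast ((2 : ℝ) ^ _), ← Real.rpow_mul (by norm_num),
    show (e : ℝ) / 256 * (256 : ℕ) = e by push_cast; ring, Real.rpow_natCast]
  exact_mod_cast h

theorem kraft_cast {t₀ t₁ t₂ B : ℕ} {ρ : ℝ}
    (h : (((t₀ * 1000 ^ 4 * 2 ^ 28 + t₁ * 1000 ^ 2 * 2 ^ 14 * B + t₂ * B ^ 2) * 2 ^ 13 : ℕ) : ℝ) ≤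
      ρ * (1000 ^ 5 * 2 ^ 28 * (2 ^ 13 - 3) : ℕ)) :
    (t₀ : ℝ) / 1000 + t₁ / 1000 ^ 2 * (B / 1000 / 2 ^ 14) +
      t₂ / 1000 ^ 3 * (B / 1000 / 2 ^ 14) ^ 2 ≤ ρ * (1 - 3 / 2 ^ 13) := by
  rw [Nat.cast_mul, Nat.cast_mul, Nat.cast_sub (by norm_num)] at h
  push_cast at h
  linarith

theorem kraft_real (hl : l ≤ 100) :
    (shareSum fun n => cellWeight n 0 l + 1 : ℕ) / 1000 +
      (shareSum fun n => shareSum fun m => cellWeight n m l + 1 : ℕ) / 1000 ^ 2 *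
        (shareSum goneWeight / 1000 / 2 ^ 14) +
      (shareSum fun n => shareSum fun m => shareSum fun m' => cellWeight n (m + m') l + 1 : ℕ) /
        1000 ^ 3 * (shareSum goneWeight / 1000 / 2 ^ 14) ^ 2 ≤
      (2 : ℝ) ^ ((normLog l : ℝ) / 256) * (1 - 3 / 2 ^ 13) :=
  kraft_cast (le_two_rpow_mul (kraft_nat l (by omega)))

theorem sum_groupWeight_le (hl : l ≤ 100) :
    ∑ a, share a * groupWeight [a] l +
      ∑ a, share a * ∑ b, share b * ∑ c, share c * groupWeight [a, b, c] l +
      ∑ a, share a * ∑ b, share b * ∑ c, share c * ∑ b', share b' * ∑ c', share c' *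
        groupWeight [a, b, c, b', c'] l ≤ 1 - 3 / 2 ^ 13 := by
  have hs : ∀ j, 0 ≤ share j := fun j => (share_pos j).le
  refine le_trans (add_le_add_three
    (sum_le_sum fun a _ => mul_le_mul_of_nonneg_left (groupWeight_single_le hl a) (hs a))
    (sum_le_sum fun a _ => mul_le_mul_of_nonneg_left
      (sum_le_sum fun b _ => mul_le_mul_of_nonneg_left
      (sum_le_sum fun c _ => mul_le_mul_of_nonneg_left
        (groupWeight_triple_le hl a b c) (hs c)) (hs b)) (hs a))
    (sum_le_sum fun a _ => mul_le_mul_of_nonneg_left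
      (sum_le_sum fun b _ => mul_le_mul_of_nonneg_left
      (sum_le_sum fun c _ => mul_le_mul_of_nonneg_left
      (sum_le_sum fun b' _ => mul_le_mul_of_nonneg_left
      (sum_le_sum fun c' _ => mul_le_mul_of_nonneg_left
        (groupWeight_quintuple_le hl a b c b' c') (hs c')) (hs b')) (hs c)) (hs b)) (hs a))) ?_
  have h := kraft_real hl
  have hpos : (0 : ℝ) < 2 ^ ((normLog l : ℝ) / 256) := by positivity
  refine le_trans (le_of_eq ?_) ((div_le_iff₀' hpos).2 h)
  refine (sum_group share _ _ (fun a c => ↑(cellWeight (runLength a) (runLength c) l + 1))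
    (fun a c c' => ↑(cellWeight (runLength a) (runLength c + runLength c') l + 1)) _).trans ?_
  simp only [cast_shareSum, ← mul_div_assoc, ← sum_div, mul_left_comm (share _), ← mul_sum]
  ring

end kraft

theorem sum_groupWeight_le_of_lt {l : ℕ} (hl : 100 < l) :
    ∑ a, share a * groupWeight [a] l +
      ∑ a, share a * ∑ b, share b * ∑ c, share c * groupWeight [a, b, c] l +
      ∑ a, share a * ∑ b, share b * ∑ c, share c * ∑ b', share b' * ∑ c', share c' *
        groupWeight [a, b, c, b', c'] l ≤ 1 - 3 / 2 ^ 13 := by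
  simp only [groupWeight, cellRewards, if_neg hl.not_ge, ← sum_mul, sum_share, Nat.cast_zero,
    zero_div, zero_sub, one_mul, Real.rpow_neg zero_le_two]
  norm_num

theorem sum_listExp_groupWeight_le (T l : ℕ) :
    ∑ m ∈ range T, listExp share (2 * m + 1) (fun u => groupWeight u l) ≤ 1 - 1 / 2 ^ 13 := by
  have hs : ∀ j, 0 ≤ share j := fun j => (share_pos j).le
  have h0 : ∀ m, 0 ≤ listExp share (2 * m + 1) (fun u => groupWeight u l) := fun m => by
    rw [← listExp_const (w := share) sum_share (2 * m + 1) (0 : ℝ)]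
    exact listExp_mono hs fun u _ => (groupWeight_pos u l).le
  have h3 : ∀ m, listExp share (2 * (m + 3) + 1) (fun u => groupWeight u l) =
      (1 / 2) ^ m / 2 ^ 13 := fun m => by
    rw [← listExp_const (w := share) sum_share (2 * (m + 3) + 1) ((1 / 2) ^ m / 2 ^ 13 : ℝ)]
    refine listExp_congr fun u hu => ?_
    rw [groupWeight_of_seven_le (by omega), hu, show (2 * (m + 3) + 1) / 2 = m + 3 by omega,
      show (-10 - (m + 3 : ℕ) : ℝ) = -((m + 13 : ℕ) : ℝ) by push_cast; ring,
      Real.rpow_neg zero_le_two, Real.rpow_natCast, one_div, inv_pow, pow_add]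
    field_simp
  refine (sum_le_sum_of_subset_of_nonneg (range_subset_range.2 (Nat.le_add_right T 3))
    fun m _ _ => h0 m).trans ?_
  have h : ∑ a, share a * groupWeight [a] l +
      ∑ a, share a * ∑ b, share b * ∑ c, share c * groupWeight [a, b, c] l +
      ∑ a, share a * ∑ b, share b * ∑ c, share c * ∑ b', share b' * ∑ c', share c' *
        groupWeight [a, b, c, b', c'] l ≤ 1 - 3 / 2 ^ 13 := by
    rcases le_or_gt l 100 with hl | hl
    exacts [sum_groupWeight_le hl, sum_groupWeight_le_of_lt hl]
  have hgeom : ∑ m ∈ range T, ((1 : ℝ) / 2) ^ m ≤ 2 := by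
    rw [geom_sum_eq (by norm_num), div_le_iff_of_neg (by norm_num)]
    have : (0 : ℝ) < (1 / 2) ^ T := by positivity
    linarith
  rw [sum_range_succ', sum_range_succ', sum_range_succ']
  simp only [h3, add_assoc, Nat.reduceAdd, ← sum_div]
  simp only [listExp]
  linarith

theorem mergeGain_le {k : ℕ} (hk : k < 21) {A B : ℝ}
    (hAB : (k : ℝ) = 0 ∨ (k - 10 : ℝ) / 2 ≤ B - A) :
    A + mergeLog k / 256 ≤ Real.logb 2 (2 ^ A + 2 ^ B) := by
  rw [Real.le_logb_iff_rpow_le (by norm_num) (by positivity), Real.rpow_add (by norm_num)]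
  rcases mergeLog_spec k hk with rfl | ⟨b, -, hb, h⟩
  · rw [show mergeLog 0 = 0 from rfl, Nat.cast_zero, zero_div, Real.rpow_zero, mul_one]
    exact le_add_of_nonneg_right (by positivity)
  rcases hAB with hk0 | hAB
  · rw [Nat.cast_eq_zero] at hk0
    subst hk0
    rw [show mergeLog 0 = 0 from rfl, Nat.cast_zero, zero_div, Real.rpow_zero, mul_one]
    exact le_add_of_nonneg_right (by positivity)
  have h₁ : (2 : ℝ) ^ ((mergeLog k : ℝ) / 256) ≤ 1 + b / 2 ^ 20 := by
    refine le_of_pow_le_pow_left₀ (n := 256) (by norm_num) (by positivity) ?_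
    rw [← Real.rpow_natCast, ← Real.rpow_mul (by norm_num),
      show (mergeLog k : ℝ) / 256 * (256 : ℕ) = mergeLog k by push_cast; ring, Real.rpow_natCast,
      show (1 : ℝ) + b / 2 ^ 20 = (2 ^ 20 + b) / 2 ^ 20 by ring, div_pow, ← pow_mul,
      le_div_iff₀ (by positivity), ← pow_add]
    exact_mod_cast h
  have h₂ : (b : ℝ) / 2 ^ 20 ≤ 2 ^ (B - A) := by
    refine le_trans ?_ (Real.rpow_le_rpow_of_exponent_le one_le_two hAB)
    refine le_of_pow_le_pow_left₀ (n := 2) (by norm_num) (by positivity) ?_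
    rw [← Real.rpow_natCast (_ ^ _), ← Real.rpow_mul (by norm_num),
      show (k - 10 : ℝ) / 2 * (2 : ℕ) = (30 + k : ℕ) - (40 : ℕ) by push_cast; ring,
      Real.rpow_sub (by norm_num), Real.rpow_natCast, Real.rpow_natCast, div_pow, ← pow_mul]
    have : (b : ℝ) ^ 2 ≤ 2 ^ (30 + k) := by exact_mod_cast hb
    gcongr
  calc (2 : ℝ) ^ A * 2 ^ ((mergeLog k : ℝ) / 256) ≤ 2 ^ A * (1 + 2 ^ (B - A)) := by
        gcongr; linarith
    _ = 2 ^ A + 2 ^ B := by rw [mul_add, mul_one, ← Real.rpow_add (by norm_num)]; simp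

theorem merge_exponent_le {x y x' y' : ℕ} (h : (x + 2560 - y) / 128 ≠ 0) :
    ((min ((x + 2560 - y) / 128 + 10 - ((x' + 2560 - y') / 128 + 1)) 20 : ℕ) : ℝ) = 0 ∨
    ((min ((x + 2560 - y) / 128 + 10 - ((x' + 2560 - y') / 128 + 1)) 20 : ℕ) - 10 : ℝ) / 2 ≤
      ((x : ℝ) - y + y' - x') / 256 := by
  by_cases h0 : min ((x + 2560 - y) / 128 + 10 - ((x' + 2560 - y') / 128 + 1)) 20 = 0
  · exact Or.inl (by exact_mod_cast h0)
  right
  generalize hk : min ((x + 2560 - y) / 128 + 10 - ((x' + 2560 - y') / 128 + 1)) 20 = k at h0 ⊢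
  have h1 : 128 * k + y + x' ≤ x + y' + 1280 := by omega
  have : (128 : ℝ) * k + y + x' ≤ x + y' + 1280 := by exact_mod_cast h1
  linarith

theorem cellRewards_merge_le (a : Fin 5) (l : ℕ) (d : Fin 5) (l' : ℕ) :
    cellRewards.v₁ a cellRewards.z cellRewards.z l + cellRewards.v₀ d l' + cellRewards.γ a l d l' ≤
      Real.logb 2 (groupWeight [a, cellRewards.z, cellRewards.z] l * groupWeight [d] l' +
        groupWeight [a] l * groupWeight [cellRewards.z, cellRewards.z, d] l') := by
  simp only [groupWeight, ← Real.rpow_add zero_lt_two]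
  generalize hA : cellRewards.v₁ a cellRewards.z cellRewards.z l + cellRewards.v₀ d l' = A
  generalize hB : cellRewards.v₀ a l + cellRewards.v₁ cellRewards.z cellRewards.z d l' = B
  have key : cellRewards.γ a l d l' = 0 → A + cellRewards.γ a l d l' ≤
      Real.logb 2 (2 ^ A + 2 ^ B) := fun h => by
    rw [h]
    simpa [show mergeLog 0 = 0 from rfl] using
      mergeGain_le (k := 0) (by norm_num) (A := A) (B := B) (Or.inl (by simp))
  by_cases hl : l ≤ 100 ∧ l' ≤ 100
  swap
  · exact key (by simp only [cellRewards, if_neg hl, Nat.cast_zero, zero_div])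
  by_cases h0 : leftLevel (runLength a) l = 0
  · exact key (by
      simp only [cellRewards, if_pos hl, mergeGain, if_pos h0, Nat.cast_zero, zero_div])
  have hγ : cellRewards.γ a l d l' = mergeLog (min (leftLevel (runLength a) l + 10 -
      rightLevel (runLength d) l') 20) / 256 := by
    simp only [cellRewards, if_pos hl, mergeGain, if_neg h0]
  rw [hγ]
  refine mergeGain_le (by omega) ?_
  have hd : B - A = ((cellLog (runLength a) 0 l : ℝ) - cellLog (runLength a) 7 l +
      cellLog 7 (runLength d) l' - cellLog (runLength d) 0 l') / 256 := by
    rw [← hA, ← hB]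
    simp only [cellRewards, if_pos hl.1, if_pos hl.2, Nat.cast_add, cast_cellGain hl.1,
      cast_cellGain hl.2, show runLength 0 = 7 from rfl]
    ring
  rw [hd]
  exact merge_exponent_le h0

theorem mergeLog_le (k : ℕ) : mergeLog k ≤ 1291 := by
  unfold mergeLog
  rcases lt_or_ge k 21 with hk | hk
  · interval_cases k <;> decide
  · rw [List.getD_eq_default _ _ (by simpa using hk)]; norm_num

theorem cellRewards_γ_le (a : Fin 5) (l : ℕ) (d : Fin 5) (l' : ℕ) : cellRewards.γ a l d l' ≤ 6 := by
  have h : mergeGain (leftLevel (runLength a) l) (rightLevel (runLength d) l') ≤ 1291 := by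
    unfold mergeGain; split
    exacts [Nat.zero_le _, mergeLog_le _]
  have h' : (mergeGain (leftLevel (runLength a) l) (rightLevel (runLength d) l') : ℝ) ≤ 1291 := by
    exact_mod_cast h
  simp only [cellRewards]
  split <;> push_cast <;> linarith

theorem cast_sumBelow_shareSum (f : ℕ → ℕ → ℕ) (N : ℕ) :
    (sumBelow (fun l => shareSum fun n => f n l) N : ℝ) =
      1000 * ∑ a, share a * ∑ l ∈ range N, (f (runLength a) l : ℝ) := by
  simp only [cast_sumBelow, cast_shareSum, ← mul_sum]
  rw [sum_comm]
  simp only [← mul_sum]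

theorem cast_sumBelow_shareSum₂ (f : ℕ → ℕ → ℕ → ℕ) (N : ℕ) :
    (sumBelow (fun l => shareSum fun n => shareSum fun m => f n m l) N : ℝ) =
      1000 ^ 2 * ∑ a, share a * ∑ c, share c * ∑ l ∈ range N,
        (f (runLength a) (runLength c) l : ℝ) := by
  rw [cast_sumBelow_shareSum fun n l => shareSum fun m => f n m l, sq, mul_assoc]
  congr 1
  rw [mul_sum]
  refine sum_congr rfl fun a _ => ?_
  rw [← cast_sumBelow]
  rw [cast_sumBelow_shareSum fun m l => f (runLength a) m l]
  ring

theorem cast_sumBelow_shareSum₃ (f : ℕ → ℕ → ℕ → ℕ → ℕ) (N : ℕ) :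
    (sumBelow (fun l => shareSum fun n => shareSum fun m => shareSum fun m' => f n m m' l) N : ℝ) =
      1000 ^ 3 * ∑ a, share a * ∑ c, share c * ∑ c', share c' * ∑ l ∈ range N,
        (f (runLength a) (runLength c) (runLength c') l : ℝ) := by
  rw [cast_sumBelow_shareSum fun n l => shareSum fun m => shareSum fun m' => f n m m' l,
    pow_succ', mul_assoc, mul_sum univ _ (1000 ^ 2 : ℝ)]
  congr 1
  refine sum_congr rfl fun a _ => ?_
  rw [← cast_sumBelow]
  rw [cast_sumBelow_shareSum₂ fun m m' l => f (runLength a) m m' l]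
  ring

section factor
variable {J : Type*} [Fintype J] (p q e : J → ℝ)

theorem sum_sum_add_mul (X Y : J → ℝ) :
    ∑ b, q b * ∑ c, p c * (X c + e b * Y c) =
      (∑ b, q b) * ∑ c, p c * X c + (∑ b, q b * e b) * ∑ c, p c * Y c := by
  rw [sum_mul, sum_mul, ← sum_add_distrib]
  refine sum_congr rfl fun b _ => ?_
  rw [mul_assoc, ← mul_add, mul_sum _ _ (e b), ← sum_add_distrib]
  congr 1
  exact sum_congr rfl fun c _ => by ring

theorem sum_sum_sum_sum_add_mul (X Y : J → J → ℝ) :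
    ∑ b, q b * ∑ c, p c * ∑ b', q b' * ∑ c', p c' * (X c c' + (e b + e b') * Y c c') =
      (∑ b, q b) ^ 2 * ∑ c, p c * ∑ c', p c' * X c c' +
        2 * (∑ b, q b) * (∑ b, q b * e b) * ∑ c, p c * ∑ c', p c' * Y c c' := by
  have h : ∀ b c, ∑ b', q b' * ∑ c', p c' * (X c c' + (e b + e b') * Y c c') =
      ((∑ b, q b) * ∑ c', p c' * X c c' + (∑ b, q b * e b) * ∑ c', p c' * Y c c') +
        e b * ((∑ b, q b) * ∑ c', p c' * Y c c') := fun b c => by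
    have := sum_sum_add_mul p q (fun b' => e b + e b') (X c) (Y c)
    rw [this]
    simp only [mul_add, sum_add_distrib, ← sum_mul]
    ring
  simp only [h]
  rw [sum_sum_add_mul p q e (fun c => (∑ b, q b) * ∑ c', p c' * X c c' +
    (∑ b, q b * e b) * ∑ c', p c' * Y c c') fun c => (∑ b, q b) * ∑ c', p c' * Y c c']
  simp only [mul_add, sum_add_distrib, mul_left_comm (p _), ← mul_sum]
  ring

theorem sum_sum_sum_add_mul (X Y : J → J → ℝ) :
    ∑ a, p a * ∑ b, q b * ∑ c, p c * (X a c + e b * Y a c) =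
      (∑ b, q b) * ∑ a, p a * ∑ c, p c * X a c +
        (∑ b, q b * e b) * ∑ a, p a * ∑ c, p c * Y a c := by
  simp only [sum_sum_add_mul]
  simp only [mul_add, sum_add_distrib, mul_left_comm (p _), ← mul_sum]

theorem sum_sum_sum_sum_sum_add_mul (X Y : J → J → J → ℝ) :
    ∑ a, p a * ∑ b, q b * ∑ c, p c * ∑ b', q b' * ∑ c', p c' *
      (X a c c' + (e b + e b') * Y a c c') =
      (∑ b, q b) ^ 2 * ∑ a, p a * ∑ c, p c * ∑ c', p c' * X a c c' +
        2 * (∑ b, q b) * (∑ b, q b * e b) * ∑ a, p a * ∑ c, p c * ∑ c', p c' * Y a c c' := by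
  simp only [sum_sum_sum_sum_add_mul]
  simp only [mul_add, sum_add_distrib, mul_left_comm (p _), ← mul_sum]

end factor

/-- Probability that a run is of type `j` and is completely deleted. -/
noncomputable def goneShare (j : Fin 5) : ℝ := share j * Real.exp (-meanLength j)

theorem goneShare_nonneg (j : Fin 5) : 0 ≤ goneShare j :=
  mul_nonneg (share_pos j).le (Real.exp_pos _).le

theorem cellWeight_le_zero (a : Fin 5) (l : ℕ) :
    (cellWeight (runLength a) 0 l : ℝ) / 2 ^ 34 ≤ burstWeight (meanLength a) 0 l := by
  simpa [meanLength] using cellWeight_le (runLength a) 0 l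

theorem cellWeight_le_one (a c : Fin 5) (l : ℕ) :
    (cellWeight (runLength a) (runLength c) l : ℝ) / 2 ^ 34 ≤
      burstWeight (meanLength a) (meanLength c) l :=
  cellWeight_le _ _ l

theorem cellWeight_le_two (a c c' : Fin 5) (l : ℕ) :
    (cellWeight (runLength a) (runLength c + runLength c') l : ℝ) / 2 ^ 34 ≤
      burstWeight (meanLength a) (meanLength c + meanLength c') l := by
  have := cellWeight_le (runLength a) (runLength c + runLength c') l
  rwa [Nat.cast_add, add_div] at this

theorem single_gain_le : (138539445524477889 / (1000 * 2 ^ 34 * 256) : ℝ) ≤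
    ∑ a, share a * ∑ l ∈ range 101, burstWeight (meanLength a) 0 l *
      (cellRewards.v₀ a l + 32) := by
  have h := single_nat
  rw [← Nat.cast_le (α := ℝ), cast_sumBelow_shareSum fun n l => cellWeight n 0 l * cellGain n 0 l,
    ← div_le_iff₀' (by norm_num)] at h
  calc _ ≤ (∑ a, share a * ∑ l ∈ range 101,
        ((cellWeight (runLength a) 0 l * cellGain (runLength a) 0 l : ℕ) : ℝ)) *
          (1 / (2 ^ 34 * 256)) := by linarith
    _ ≤ _ := by
      simp only [sum_mul, mul_assoc]
      refine sum_le_sum fun a _ => mul_le_mul_of_nonneg_left (sum_le_sum fun l hl => ?_)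
        (share_pos a).le
      have hl : l ≤ 100 := by rw [mem_range] at hl; omega
      refine le_trans (le_of_eq ?_) (mul_le_mul_of_nonneg_right (cellWeight_le_zero a l) ?_)
      · simp only [cellRewards, if_pos hl]; push_cast; ring
      · simp only [cellRewards, if_pos hl, sub_add_cancel]; positivity

theorem double_gain_le : (∑ b, goneShare b) * (141599145104931011474 / (1000 ^ 2 * 2 ^ 34 * 256)) +
    (∑ b, goneShare b * (goneLog (runLength b) / 256)) *
      (16331826344526130 / (1000 ^ 2 * 2 ^ 34)) ≤
    ∑ a, share a * ∑ b, goneShare b * ∑ c, share c * ∑ l ∈ range 101,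
      burstWeight (meanLength a) (meanLength c) l * (cellRewards.v₁ a b c l + 46) := by
  have h := double_nat
  have h' := double_mass_nat
  rw [← Nat.cast_le (α := ℝ), cast_sumBelow_shareSum₂ fun n m l => cellWeight n m l * cellGain n m l,
    ← div_le_iff₀' (by norm_num)] at h
  rw [← Nat.cast_le (α := ℝ), cast_sumBelow_shareSum₂ cellWeight,
    ← div_le_iff₀' (by norm_num)] at h'
  have hq : 0 ≤ ∑ b, goneShare b := sum_nonneg fun b _ => goneShare_nonneg b
  have he : 0 ≤ ∑ b, goneShare b * ((goneLog (runLength b) : ℝ) / 256) :=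
    sum_nonneg fun b _ => mul_nonneg (goneShare_nonneg b) (by positivity)
  refine (add_le_add (mul_le_mul_of_nonneg_left (?_ : _ ≤ ∑ a, share a * ∑ c, share c *
    ((∑ l ∈ range 101, ((cellWeight (runLength a) (runLength c) l *
      cellGain (runLength a) (runLength c) l : ℕ) : ℝ)) * (1 / (2 ^ 34 * 256)))) hq)
    (mul_le_mul_of_nonneg_left (?_ : _ ≤ ∑ a, share a * ∑ c, share c *
      ((∑ l ∈ range 101, (cellWeight (runLength a) (runLength c) l : ℝ)) * (1 / 2 ^ 34))) he)).trans ?_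
  · simp only [← mul_assoc, ← sum_mul]; linarith
  · simp only [← mul_assoc, ← sum_mul]; linarith
  rw [← sum_sum_sum_add_mul]
  refine sum_le_sum fun a _ => mul_le_mul_of_nonneg_left (sum_le_sum fun b _ =>
    mul_le_mul_of_nonneg_left (sum_le_sum fun c _ => mul_le_mul_of_nonneg_left ?_ (share_pos c).le)
    (goneShare_nonneg b)) (share_pos a).le
  rw [sum_mul, sum_mul, mul_sum, ← sum_add_distrib]
  refine sum_le_sum fun l hl => ?_
  have hl : l ≤ 100 := by rw [mem_range] at hl; omega
  refine le_trans (le_of_eq ?_) (mul_le_mul_of_nonneg_right (cellWeight_le_one a c l) ?_)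
  · simp only [cellRewards, if_pos hl]; push_cast; ring
  · simp only [cellRewards, if_pos hl, sub_add_cancel]; positivity

theorem triple_gain_le :
    (∑ b, goneShare b) ^ 2 * (145494920331872645354755 / (1000 ^ 3 * 2 ^ 34 * 256)) +
    2 * (∑ b, goneShare b) * (∑ b, goneShare b * (goneLog (runLength b) / 256)) *
      (16327686893995724629 / (1000 ^ 3 * 2 ^ 34)) ≤
    ∑ a, share a * ∑ b, goneShare b * ∑ c, share c * ∑ b', goneShare b' * ∑ c', share c' *
      ∑ l ∈ range 101, burstWeight (meanLength a) (meanLength c + meanLength c') l *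
        (cellRewards.v₂ a b c b' c' l + 60) := by
  have h := triple_nat
  have h' := triple_mass_nat
  rw [← Nat.cast_le (α := ℝ), cast_sumBelow_shareSum₃ fun n m m' l => cellWeight n (m + m') l *
    cellGain n (m + m') l, ← div_le_iff₀' (by norm_num)] at h
  rw [← Nat.cast_le (α := ℝ), cast_sumBelow_shareSum₃ fun n m m' l => cellWeight n (m + m') l,
    ← div_le_iff₀' (by norm_num)] at h'
  have hq : 0 ≤ ∑ b, goneShare b := sum_nonneg fun b _ => goneShare_nonneg b
  have he : 0 ≤ ∑ b, goneShare b * ((goneLog (runLength b) : ℝ) / 256) :=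
    sum_nonneg fun b _ => mul_nonneg (goneShare_nonneg b) (by positivity)
  refine (add_le_add (mul_le_mul_of_nonneg_left (?_ : _ ≤ ∑ a, share a * ∑ c, share c *
    ∑ c', share c' * ((∑ l ∈ range 101, ((cellWeight (runLength a) (runLength c + runLength c') l *
      cellGain (runLength a) (runLength c + runLength c') l : ℕ) : ℝ)) *
        (1 / (2 ^ 34 * 256)))) (pow_nonneg hq 2))
    (mul_le_mul_of_nonneg_left (?_ : _ ≤ ∑ a, share a * ∑ c, share c * ∑ c', share c' *
      ((∑ l ∈ range 101, (cellWeight (runLength a) (runLength c + runLength c') l : ℝ)) *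
        (1 / 2 ^ 34))) (mul_nonneg (mul_nonneg zero_le_two hq) he))).trans ?_
  · simp only [← mul_assoc, ← sum_mul]; linarith
  · simp only [← mul_assoc, ← sum_mul]; linarith
  rw [← sum_sum_sum_sum_sum_add_mul]
  refine sum_le_sum fun a _ => mul_le_mul_of_nonneg_left (sum_le_sum fun b _ =>
    mul_le_mul_of_nonneg_left (sum_le_sum fun c _ => mul_le_mul_of_nonneg_left (sum_le_sum fun b' _ =>
    mul_le_mul_of_nonneg_left (sum_le_sum fun c' _ => mul_le_mul_of_nonneg_left ?_ (share_pos c').le)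
    (goneShare_nonneg b')) (share_pos c).le) (goneShare_nonneg b)) (share_pos a).le
  rw [sum_mul, sum_mul, mul_sum, ← sum_add_distrib]
  refine sum_le_sum fun l hl => ?_
  have hl : l ≤ 100 := by rw [mem_range] at hl; omega
  refine le_trans (le_of_eq ?_) (mul_le_mul_of_nonneg_right (cellWeight_le_two a c c' l) ?_)
  · simp only [cellRewards, if_pos hl]; push_cast; ring
  · simp only [cellRewards, if_pos hl, sub_add_cancel]; positivity

theorem meanMergeGain_div_le (i : ℕ) : (meanMergeGain i : ℝ) / (1000 * 2 ^ 34) ≤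
    ∑ d, share d * ∑ l ∈ range 101, burstWeight (meanLength d) 0 l *
      mergeGain i (rightLevel (runLength d) l) := by
  have hn : ∀ d l, 0 ≤ burstWeight (meanLength d) 0 l := fun d l =>
    burstWeight_nonneg (meanLength_nonneg d) le_rfl l
  rcases le_or_gt 27 i with hi | hi
  · rw [meanMergeGain, List.getD_eq_default _ _ (by simpa using hi), Nat.cast_zero, zero_div]
    exact sum_nonneg fun d _ => mul_nonneg (share_pos d).le (sum_nonneg fun l _ =>
      mul_nonneg (hn d l) (Nat.cast_nonneg _))
  have h := meanMergeGain_le i hi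
  rw [← Nat.cast_le (α := ℝ), cast_sumBelow_shareSum fun n l => cellWeight n 0 l *
    mergeGain i (rightLevel n l), ← div_le_iff₀' (by norm_num)] at h
  rw [← div_div]
  refine (div_le_div_of_nonneg_right h (by positivity)).trans ?_
  simp only [sum_div, mul_div_assoc]
  refine sum_le_sum fun d _ => mul_le_mul_of_nonneg_left (sum_le_sum fun l _ => ?_) (share_pos d).le
  refine le_trans (le_of_eq ?_) (mul_le_mul_of_nonneg_right (cellWeight_le_zero d l)
    (Nat.cast_nonneg _))
  push_cast; ring

theorem merge_gain_le : share 0 * (35170684050143272827326286385 / (1000 ^ 2 * 2 ^ 68 * 256)) ≤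
    ∑ a, share a * (share 0 * ∑ l ∈ range 101, burstWeight (meanLength a) (meanLength 0) l *
      ∑ d, share d * ∑ l' ∈ range 101, burstWeight (meanLength d) 0 l' *
        cellRewards.γ a l d l') := by
  have h := merge_nat
  rw [← Nat.cast_le (α := ℝ), cast_sumBelow_shareSum fun n l => cellWeight n 7 l *
    meanMergeGain (leftLevel n l), ← div_le_iff₀' (by norm_num), Nat.cast_ofNat] at h
  simp only [mul_left_comm _ (share 0), ← mul_sum]
  refine mul_le_mul_of_nonneg_left ?_ (share_pos 0).le
  rw [show (1000 ^ 2 * 2 ^ 68 * 256 : ℝ) = 1000 * (1000 * 2 ^ 68 * 256) by norm_num, ← div_div]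
  refine (div_le_div_of_nonneg_right h (by positivity)).trans ?_
  simp only [sum_div, mul_div_assoc]
  refine sum_le_sum fun a _ => mul_le_mul_of_nonneg_left (sum_le_sum fun l hl => ?_) (share_pos a).le
  have hl : l ≤ 100 := by rw [mem_range] at hl; omega
  have hγ : (meanMergeGain (leftLevel (runLength a) l) : ℝ) / (1000 * 2 ^ 34) / 256 ≤
      ∑ d, share d * ∑ l' ∈ range 101, burstWeight (meanLength d) 0 l' * cellRewards.γ a l d l' := by
    refine (div_le_div_of_nonneg_right (meanMergeGain_div_le _) (by norm_num)).trans (le_of_eq ?_)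
    simp only [sum_div, mul_div_assoc]
    refine sum_congr rfl fun d _ => ?_
    congr 1
    refine sum_congr rfl fun l' hl' => ?_
    have hl' : l' ≤ 100 := by rw [mem_range] at hl'; omega
    simp only [cellRewards, if_pos (And.intro hl hl')]
  refine le_trans (le_of_eq ?_) (mul_le_mul (cellWeight_le_one a 0 l) hγ (by positivity)
    (burstWeight_nonneg (meanLength_nonneg a) (meanLength_nonneg 0) l))
  rw [show runLength 0 = 7 from rfl]
  push_cast; ring

theorem goneShare_eq (j : Fin 5) : goneShare j = share j * Real.exp (-(1 / 3)) ^ runLength j := by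
  rw [goneShare, meanLength, exp_neg_third_pow]

theorem le_goneShare (j : Fin 5) :
    share j * (13217669706725904384 / 2 ^ 64) ^ runLength j ≤ goneShare j := by
  rw [goneShare_eq]
  exact mul_le_mul_of_nonneg_left (pow_le_pow_left₀ (by norm_num) le_exp_neg_third _)
    (share_pos j).le

theorem goneShare_le (j : Fin 5) :
    goneShare j ≤ share j * (13217669707212187648 / 2 ^ 64) ^ runLength j := by
  rw [goneShare_eq]
  exact mul_le_mul_of_nonneg_left (pow_le_pow_left₀ (Real.exp_pos _).le exp_neg_third_le _)
    (share_pos j).le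

theorem le_goneShare_zero : 0.049164 ≤ goneShare 0 := by
  refine le_trans ?_ (le_goneShare 0)
  norm_num [share, runShare, runLength]

theorem le_sum_goneShare : 0.0493464 ≤ ∑ j, goneShare j := by
  refine le_trans ?_ (sum_le_sum fun j _ => le_goneShare j)
  simp only [share, runShare, runLength, Fin.sum_univ_five, Matrix.cons_val]
  norm_num

theorem sum_goneShare_le : ∑ j, goneShare j ≤ 0.0493466 := by
  refine le_trans (sum_le_sum fun j _ => goneShare_le j) ?_
  simp only [share, runShare, runLength, Fin.sum_univ_five, Matrix.cons_val]
  norm_num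

theorem le_sum_goneShare_mul_goneLog :
    0.5233 ≤ ∑ j, goneShare j * ((goneLog (runLength j) : ℝ) / 256) := by
  refine le_trans ?_ (sum_le_sum fun j _ =>
    mul_le_mul_of_nonneg_right (le_goneShare j) (by positivity))
  simp only [share, runShare, runLength, Fin.sum_univ_five, Matrix.cons_val]
  norm_num [goneLog]

/-- Mean number of surviving bits of a run. -/
noncomputable def totalLength : ℝ := ∑ j, share j * meanLength j

theorem totalLength_eq : totalLength = 22366 / 3000 := by
  simp only [totalLength, share, meanLength, runShare, runLength, Fin.sum_univ_five,
    Matrix.cons_val]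
  norm_num

theorem cost_lt {p : ℝ} (h₁ : 0.0493464 ≤ p) (h₂ : p ≤ 0.0493466) :
    Rewards.cost 32 46 60 10 (0.12211 * totalLength) p < 33.7243 := by
  rw [totalLength_eq, Rewards.cost]
  have h₃ : (p + 0.12211 * (22366 / 3000) * (1 + p)) / (1 - p) ≤ 1.06 := by
    rw [div_le_iff₀ (by linarith)]; linarith
  have h₄ : p ^ 2 ≤ 0.0493466 ^ 2 := by gcongr
  have h₅ : p ^ 3 ≤ 0.0493466 ^ 3 := by gcongr
  have h₆ : 0.0493464 ^ 3 ≤ p ^ 3 := by gcongr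
  have h₇ := mul_le_mul_of_nonneg_left h₃ (by positivity : 0 ≤ p ^ 3)
  norm_num at h₃ h₄ h₅ h₆ h₇ ⊢
  linarith

theorem lt_gain : 33.7243 < cellRewards.gain 32 46 60 100 (poissonLaw share meanLength) := by
  rw [Rewards.gain_poissonLaw]
  · have h₀ := single_gain_le
    have h₁ := double_gain_le
    have h₂ := triple_gain_le
    have h₃ := merge_gain_le
    have hp := le_sum_goneShare
    have he := le_sum_goneShare_mul_goneLog
    have hg := le_goneShare_zero
    refine lt_of_lt_of_le ?_ (add_le_add (add_le_add_three h₀ h₁ h₂)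
      (mul_le_mul_of_nonneg_left h₃ (goneShare_nonneg 0)))
    generalize ∑ b, goneShare b = P at hp ⊢
    generalize ∑ b, goneShare b * ((goneLog (runLength b) : ℝ) / 256) = E at he ⊢
    rw [show share cellRewards.z * Real.exp (-meanLength cellRewards.z) = goneShare 0 from rfl,
      show share 0 = 0.507 by norm_num [share, runShare]]
    have hP : 0.0493464 ^ 2 ≤ P ^ 2 := by gcongr
    have hPE : 0.0493464 * 0.5233 ≤ P * E := by gcongr
    clear h₀ h₁ h₂ h₃
    norm_num at hp he hg hP hPE ⊢
    linarith
  · intro a b c l hl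
    simp [cellRewards, hl.not_ge]
  · intro a b c b' c' l hl
    simp [cellRewards, hl.not_ge]
  · intro a l d l' hl
    have : ¬(l ≤ 100 ∧ l' ≤ 100) := by omega
    simp [cellRewards, this]

theorem exists_linear_le_Cdel {d : ℝ} (hd₁ : 0 ≤ d) (hd₂ : d < 1) {τ : ℝ} (hτ : totalLength < τ * (1 - d)) :
    ∃ C' : ℝ, ∀ M n : ℕ, τ * M ≤ n → M * (0.12211 * totalLength) - C' ≤ Cdel n d := by
  have hlog : ∀ x : ℝ, Real.logb 2 (2 ^ x) = x := fun x => Real.logb_rpow (by norm_num) (by norm_num)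
  refine linear_le_Cdel_of_poisson hd₁ hd₂ (p := share) (Λ := meanLength) (R := cellRewards)
    (g := groupWeight) (η := 1 / 2 ^ 13) (κ := 10) (B := 6) (σ₀ := 32) (σ₁ := 46) (σ₂ := 60) (N := 100)
    share_pos sum_share meanLength_nonneg ?_ (by norm_num) groupWeight_pos (by norm_num) (by norm_num)
    sum_listExp_groupWeight_le (fun a l => (hlog _).ge) (fun a b c l => (hlog _).ge)
    (fun a b c b' c' l => (hlog _).ge) (fun u l hu => ?_) cellRewards_merge_le ?_ ?_ ?_ ?_
    cellRewards_γ_le ?_ ?_ hτ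
  · rw [totalLength_eq]; norm_num
  · rw [groupWeight_of_seven_le hu, hlog]
  · intro a l hl
    simp [cellRewards, hl.not_ge]
  · intro a b c l hl
    simp [cellRewards, hl.not_ge]
  · intro a b c b' c' l hl
    simp [cellRewards, hl.not_ge]
  · intro a l d l' hl
    have : ¬(l ≤ 100 ∧ l' ≤ 100) := by omega
    simp [cellRewards, this]
  · exact (cost_lt le_sum_goneShare sum_goneShare_le).trans lt_gain
  · exact sum_goneShare_le.trans_lt (by norm_num)

/-- For every `d ∈ (0,1)`, the capacity of the binary deletion
channel satisfies `C(BDC_d) > 0.1221 · (1 − d)`: for every real `L`, if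
`C_n(d)/n → L` as `n → ∞`, then `L > 0.1221 · (1 − d)`. -/
theorem bdc_lower_bound (d : ℝ) (hd₁ : 0 < d) (hd₂ : d < 1) (L : ℝ)
    (hL : Filter.Tendsto (fun n : ℕ => Cdel n d / n) Filter.atTop (nhds L)) :
    L > 0.1221 * (1 - d) := by
  have hΛ : 0 < totalLength := by rw [totalLength_eq]; norm_num
  have hd : 0 < 1 - d := sub_pos.2 hd₂
  obtain ⟨C, hC⟩ := exists_linear_le_Cdel hd₁.le hd₂ (τ := 1.00001 * totalLength / (1 - d)) (by
    rw [div_mul_cancel₀ _ hd.ne']; linarith)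
  refine lt_of_lt_of_le ?_ (div_le_of_linear_le (by positivity) hC hL)
  rw [div_div_eq_mul_div, lt_div_iff₀ (by positivity)]
  nlinarith [mul_pos hΛ hd]
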